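/- arXiv:1412.2727 — 3 statements merged into one kernel-verified Lean document; each statement's English description precedes it below -/
import Mathlib

section
/- Let f and g be continuous real-valued functions on S³, odd with respect to 𝒪, and let ζ ∈ S³. Assume that for every w ∈ S²(ζ) there exists a rotation φ_w ∈ SO(3, S²(w)) with φ_w(ζ) = ±ζ such that f∘φ_w = g on S²(w). If α ∈ [0,2] is irrational, then Ξ_α ⊆ Ξ₀; that is, if w ∈ S²(ζ) admits a rotation by the angle απ about ζ carrying f to g on S²(w), then f = g on S²(w). -/
noncomputable section

open scoped RealInnerProductSpace

/-- `ℝ⁴` as a Euclidean space. -/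
abbrev E4 := EuclideanSpace ℝ (Fin 4)

/-- The unit sphere `S³` in `ℝ⁴`. -/
def sph : Set E4 := Metric.sphere (0 : E4) 1

/-- The great subsphere `S²(w) = {θ ∈ S³ : θ·w = 0}`. -/
def S2 (w : E4) : Set E4 := {θ ∈ sph | ⟪θ, w⟫ = 0}

/-- The orthogonal transformation `𝒪` determined by `ζ`: for a unit vector `ζ` the map
`x ↦ 2⟪x,ζ⟫ζ - x` satisfies `𝒪 ζ = ζ` and `𝒪 = -I` on `ζ^⊥`. -/
def Ocal (ζ x : E4) : E4 := (2 * ⟪x, ζ⟫) • ζ - x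

/-- `φ` is (the extension to `ℝ⁴` of) an element of `SO(3, S²(w))`:
a linear isometry of `ℝ⁴` fixing `w`, of determinant `1`, i.e. a rotation
of the `3`-dimensional subspace `w^⊥`. -/
def IsRot (w : E4) (φ : E4 ≃ₗᵢ[ℝ] E4) : Prop :=
  φ w = w ∧ LinearMap.det (φ.toLinearEquiv : E4 →ₗ[ℝ] E4) = 1

/-- `φ ∈ SO(3, S²(w))` is a rotation by the angle `α·π` around the axis `u ∈ S²(w)`:
it fixes `w` and `u`, and turns the plane orthogonal to `w` and `u` by the angle `α·π`. -/
def IsRotAngleAbout (w u : E4) (α : ℝ) (φ : E4 ≃ₗᵢ[ℝ] E4) : Prop :=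
  IsRot w φ ∧ φ u = u ∧
    ∀ v : E4, ⟪v, w⟫ = 0 → ⟪v, u⟫ = 0 →
      ⟪φ v, v⟫ = Real.cos (α * Real.pi) * ⟪v, v⟫

/-- The set `Ξ_α`: directions `w ∈ S²(ζ)` admitting a rotation by the angle `α·π`
about `ζ` carrying `f` to `g` on `S²(w)`. -/
def Xi (f g : E4 → ℝ) (ζ : E4) (α : ℝ) : Set E4 :=
  {w ∈ S2 ζ | ∃ φ : E4 ≃ₗᵢ[ℝ] E4, IsRotAngleAbout w ζ α φ ∧ ∀ θ ∈ S2 w, f (φ θ) = g θ}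

lemma integral_sin_pow_mul_integral_sin_pow_succ (n : ℕ) :
    (∫ x in (0:ℝ)..Real.pi, Real.sin x ^ (n + 1)) * (∫ x in (0:ℝ)..Real.pi, Real.sin x ^ n) =
      2 * Real.pi / (n + 1) := by
  induction n with
  | zero => norm_num
  | succ n ih =>
    have h2 := integral_sin_pow (a := 0) (b := Real.pi) n
    simp only [Real.sin_zero, Real.sin_pi, ne_eq, Nat.add_eq_zero_iff, one_ne_zero, and_false,
      not_false_eq_true, zero_pow, zero_mul, sub_self, zero_div, zero_add] at h2
    have h3 : (n : ℝ) + 1 ≠ 0 := by positivity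
    have h4 : (n : ℝ) + 2 ≠ 0 := by positivity
    have h5 : (n : ℝ) + 1 + 1 ≠ 0 := by positivity
    rw [show n + 1 + 1 = n + 2 from rfl, h2, mul_assoc,
      mul_comm (∫ x in (0:ℝ)..Real.pi, Real.sin x ^ n), ih]
    push_cast
    field_simp
    ring

/-- Archimedes' theorem for polynomial functions: the average over a hemisphere of a function of
one coordinate is its average over the range of this coordinate. -/
lemma integral_hemisphere_polynomial (p : Polynomial ℝ) (r : ℝ) :
    (∫ θ in (0:ℝ)..Real.pi, Real.sin θ *
      ∫ φ in (0:ℝ)..Real.pi, p.eval (r * Real.sin θ * Real.sin φ)) =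
      2 * Real.pi * ∫ u in (0:ℝ)..1, p.eval (r * u) := by
  induction p using Polynomial.induction_on' with
  | add p q hp hq =>
    have e1 : ∀ θ : ℝ, (∫ φ in (0:ℝ)..Real.pi, (p + q).eval (r * Real.sin θ * Real.sin φ)) =
        (∫ φ in (0:ℝ)..Real.pi, p.eval (r * Real.sin θ * Real.sin φ)) +
        ∫ φ in (0:ℝ)..Real.pi, q.eval (r * Real.sin θ * Real.sin φ) := by
      intro θ
      simp only [Polynomial.eval_add]
      apply intervalIntegral.integral_add <;>
      · apply Continuous.intervalIntegrable
        fun_prop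
    have e2 : (∫ u in (0:ℝ)..1, (p + q).eval (r * u)) =
        (∫ u in (0:ℝ)..1, p.eval (r * u)) + ∫ u in (0:ℝ)..1, q.eval (r * u) := by
      simp only [Polynomial.eval_add]
      apply intervalIntegral.integral_add <;>
      · apply Continuous.intervalIntegrable
        fun_prop
    have hc : ∀ p : Polynomial ℝ, Continuous fun θ : ℝ => Real.sin θ *
        ∫ φ in (0:ℝ)..Real.pi, p.eval (r * Real.sin θ * Real.sin φ) := by
      intro p
      refine Real.continuous_sin.mul ?_
      apply intervalIntegral.continuous_parametric_intervalIntegral_of_continuous'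
      unfold Function.uncurry
      fun_prop
    simp only [e1, e2, mul_add]
    rw [intervalIntegral.integral_add ((hc p).intervalIntegrable _ _)
      ((hc q).intervalIntegrable _ _), hp, hq]
  | monomial n a =>
    simp only [Polynomial.eval_monomial, mul_pow, intervalIntegral.integral_const_mul, integral_pow]
    have e : ∀ θ : ℝ, Real.sin θ * (a * (r ^ n * Real.sin θ ^ n *
        ∫ φ in (0:ℝ)..Real.pi, Real.sin φ ^ n)) =
        (a * r ^ n * ∫ φ in (0:ℝ)..Real.pi, Real.sin φ ^ n) * Real.sin θ ^ (n + 1) := by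
      intro θ
      ring
    simp only [e, intervalIntegral.integral_const_mul]
    rw [mul_assoc, mul_comm (∫ φ in (0:ℝ)..Real.pi, Real.sin φ ^ n),
      integral_sin_pow_mul_integral_sin_pow_succ]
    simp
    ring

lemma integral_hemisphere {k : ℝ → ℝ} (hk : Continuous k) {r : ℝ} (hr : r ∈ Set.Icc (0:ℝ) 1) :
    (∫ θ in (0:ℝ)..Real.pi, Real.sin θ *
      ∫ φ in (0:ℝ)..Real.pi, k (r * Real.sin θ * Real.sin φ)) =
      2 * Real.pi * ∫ u in (0:ℝ)..1, k (r * u) := by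
  have hpi := Real.pi_pos
  refine eq_of_forall_dist_le fun ε hε => ?_
  rw [Real.dist_eq]
  set C : ℝ := Real.pi * Real.pi + 2 * Real.pi with hC
  have hC0 : 0 < C := by positivity
  obtain ⟨p, hp⟩ := exists_polynomial_near_of_continuousOn 0 1 k hk.continuousOn (ε / C)
    (by positivity)
  have h_int : ∀ {q : ℝ → ℝ}, Continuous q → Continuous fun θ : ℝ => Real.sin θ *
      ∫ φ in (0:ℝ)..Real.pi, q (r * Real.sin θ * Real.sin φ) := by
    intro q hq
    refine Real.continuous_sin.mul ?_
    apply intervalIntegral.continuous_parametric_intervalIntegral_of_continuous'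
    unfold Function.uncurry
    fun_prop
  have b1 : |(∫ θ in (0:ℝ)..Real.pi, Real.sin θ *
      ∫ φ in (0:ℝ)..Real.pi, p.eval (r * Real.sin θ * Real.sin φ)) -
      ∫ θ in (0:ℝ)..Real.pi, Real.sin θ *
      ∫ φ in (0:ℝ)..Real.pi, k (r * Real.sin θ * Real.sin φ)| ≤ ε / C * Real.pi * Real.pi := by
    rw [← intervalIntegral.integral_sub ((h_int p.continuous).intervalIntegrable _ _)
      ((h_int hk).intervalIntegrable _ _)]
    refine (intervalIntegral.norm_integral_le_of_norm_le_const
      (E := ℝ) (C := ε / C * Real.pi) fun θ hθ => ?_).trans (by rw [sub_zero, abs_of_pos hpi])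
    rw [Set.uIoc_of_le hpi.le] at hθ
    have s0 : 0 ≤ Real.sin θ := Real.sin_nonneg_of_nonneg_of_le_pi hθ.1.le hθ.2
    rw [← mul_sub, ← intervalIntegral.integral_sub
      (Continuous.intervalIntegrable (by fun_prop) _ _)
      (Continuous.intervalIntegrable (by fun_prop) _ _), norm_mul, Real.norm_of_nonneg s0]
    have : ‖∫ φ in (0:ℝ)..Real.pi, p.eval (r * Real.sin θ * Real.sin φ) -
        k (r * Real.sin θ * Real.sin φ)‖ ≤ ε / C * |Real.pi - 0| := by
      refine intervalIntegral.norm_integral_le_of_norm_le_const fun φ hφ => ?_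
      rw [Set.uIoc_of_le hpi.le] at hφ
      have t0 : 0 ≤ Real.sin φ := Real.sin_nonneg_of_nonneg_of_le_pi hφ.1.le hφ.2
      refine (hp _ ⟨by have := hr.1; positivity, ?_⟩).le
      exact mul_le_one₀ (mul_le_one₀ hr.2 s0 (Real.sin_le_one _)) t0 (Real.sin_le_one _)
    rw [sub_zero, abs_of_pos hpi] at this
    exact (mul_le_of_le_one_left (norm_nonneg _) (Real.sin_le_one _)).trans this
  have b2 : |(∫ u in (0:ℝ)..1, p.eval (r * u)) - ∫ u in (0:ℝ)..1, k (r * u)| ≤ ε / C := by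
    rw [← intervalIntegral.integral_sub (Continuous.intervalIntegrable (by fun_prop) _ _)
      (Continuous.intervalIntegrable (by fun_prop) _ _)]
    refine (intervalIntegral.norm_integral_le_of_norm_le_const
      (E := ℝ) (C := ε / C) fun u hu => ?_).trans (by rw [sub_zero, abs_one, mul_one])
    rw [Set.uIoc_of_le zero_le_one] at hu
    exact (hp _ ⟨mul_nonneg hr.1 hu.1.le, mul_le_one₀ hr.2 hu.1.le hu.2⟩).le
  rw [integral_hemisphere_polynomial] at b1
  have e : ε = ε / C * Real.pi * Real.pi + 2 * Real.pi * (ε / C) := by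
    have : ε = ε / C * C := by field_simp
    rw [hC] at this ⊢
    linarith
  have b3 := mul_le_mul_of_nonneg_left b2 (show 0 ≤ 2 * Real.pi by positivity)
  rw [abs_le] at b1 ⊢
  rw [← abs_of_pos (show 0 < 2 * Real.pi by positivity), ← abs_mul,
    abs_of_pos (show 0 < 2 * Real.pi by positivity), abs_le] at b3
  constructor <;> linarith [b1.1, b1.2, b3.1, b3.2]

/-- Injectivity of the Abel-type transform of zonal functions, at the pole. -/
lemma eq_zero_of_integral_mul_sin_eq_zero {k : ℝ → ℝ} (hk : Continuous k)
    (h : ∀ s ∈ Set.Icc (0:ℝ) 1, ∫ φ in (0:ℝ)..Real.pi, k (s * Real.sin φ) = 0) : k 1 = 0 := by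
  have hpi := Real.pi_pos
  have h0 : ∀ r ∈ Set.Icc (0:ℝ) 1, ∫ u in (0:ℝ)..r, k u = 0 := by
    intro r hr
    have := integral_hemisphere hk hr
    rw [intervalIntegral.integral_congr (g := fun _ => 0), intervalIntegral.integral_zero] at this
    · have h2 : ∫ u in (0:ℝ)..1, k (r * u) = 0 := by
        have h3 : 2 * Real.pi ≠ 0 := by positivity
        simpa [h3, hpi.ne'] using this
      simpa [h2] using (intervalIntegral.smul_integral_comp_mul_left (a := 0) (b := 1) k r).symm
    · intro θ hθ
      rw [Set.uIcc_of_le hpi.le] at hθ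
      have s0 : 0 ≤ Real.sin θ := Real.sin_nonneg_of_nonneg_of_le_pi hθ.1 hθ.2
      simp only
      rw [h _ ⟨mul_nonneg hr.1 s0, mul_le_one₀ hr.2 s0 (Real.sin_le_one _)⟩, mul_zero]
  have hd : HasDerivWithinAt (fun r => ∫ u in (0:ℝ)..r, k u) (k 1) (Set.Icc 0 1) 1 :=
    (intervalIntegral.integral_hasDerivAt_right (hk.intervalIntegrable _ _)
      (hk.stronglyMeasurableAtFilter _ _) hk.continuousAt).hasDerivWithinAt
  have hd0 : HasDerivWithinAt (fun r => ∫ u in (0:ℝ)..r, k u) 0 (Set.Icc 0 1) 1 :=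
    (hasDerivWithinAt_const 1 _ (0:ℝ)).congr h0 (h0 1 (by simp))
  exact (uniqueDiffOn_Icc zero_lt_one 1 (by simp)).eq_deriv _ hd hd0

lemma exists_eq_mul_cos_and_eq_mul_sin {x y R : ℝ} (hR : 0 ≤ R) (h : x ^ 2 + y ^ 2 = R ^ 2) :
    ∃ δ : ℝ, x = R * Real.cos δ ∧ y = R * Real.sin δ := by
  have hn : ‖(⟨x, y⟩ : ℂ)‖ = R := by
    rw [← sq_eq_sq₀ (norm_nonneg _) hR, ← h, Complex.sq_norm, Complex.normSq_mk]
    ring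
  refine ⟨Complex.arg ⟨x, y⟩, ?_, ?_⟩
  · rw [← hn, Complex.norm_mul_cos_arg]
  · rw [← hn, Complex.norm_mul_sin_arg]

section Circle

variable {V : Type*} [NormedAddCommGroup V] [InnerProductSpace ℝ V]

/-- Funk's theorem: a continuous function whose integrals over all great half-circles vanish is
zero. -/
lemma eq_zero_of_integral_half_circle_eq_zero (K : Submodule ℝ V) {h : V → ℝ} (hc : Continuous h)
    (h_int : ∀ A ∈ K, ∀ B ∈ K, ⟪A, A⟫ = 1 → ⟪B, B⟫ = 1 → ⟪A, B⟫ = 0 →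
      ∫ θ in (0:ℝ)..Real.pi, h (Real.cos θ • A + Real.sin θ • B) = 0)
    {p a b : V} (hp : p ∈ K) (ha : a ∈ K) (hb : b ∈ K) (hpp : ⟪p, p⟫ = 1) (haa : ⟪a, a⟫ = 1)
    (hbb : ⟪b, b⟫ = 1) (hpa : ⟪p, a⟫ = 0) (hpb : ⟪p, b⟫ = 0) (hab : ⟪a, b⟫ = 0) : h p = 0 := by
  have hap : ⟪a, p⟫ = 0 := by rw [real_inner_comm, hpa]
  have hbp : ⟪b, p⟫ = 0 := by rw [real_inner_comm, hpb]
  have hba : ⟪b, a⟫ = 0 := by rw [real_inner_comm, hab]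
  set F : ℝ → ℝ → ℝ := fun s ψ =>
    h (s • p + √(1 - s ^ 2) • (Real.cos ψ • a + Real.sin ψ • b)) with hF
  have hFc : Continuous (Function.uncurry F) := by
    unfold Function.uncurry
    fun_prop
  have hk : Continuous fun s => ∫ ψ in (0:ℝ)..2 * Real.pi, F s ψ :=
    intervalIntegral.continuous_parametric_intervalIntegral_of_continuous' hFc _ _
  have key := eq_zero_of_integral_mul_sin_eq_zero hk ?_
  · simpa [hF, Real.pi_ne_zero] using key
  intro s hs
  have hq : √(1 - s ^ 2) ^ 2 = 1 - s ^ 2 := Real.sq_sqrt (by nlinarith [hs.1, hs.2])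
  set q := √(1 - s ^ 2)
  set G : ℝ → ℝ → ℝ := fun φ ψ =>
    h (Real.cos φ • (-Real.sin ψ • a + Real.cos ψ • b) +
      Real.sin φ • (s • p + q • (Real.cos ψ • a + Real.sin ψ • b))) with hG
  have hGc : Continuous (Function.uncurry G) := by
    unfold Function.uncurry
    fun_prop
  have hrot : ∀ φ, ∫ ψ in (0:ℝ)..2 * Real.pi, F (s * Real.sin φ) ψ =
      ∫ ψ in (0:ℝ)..2 * Real.pi, G φ ψ := by
    intro φ
    have hle : 0 ≤ 1 - (s * Real.sin φ) ^ 2 := by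
      have h1 : s ^ 2 ≤ 1 := by nlinarith [hs.1, hs.2]
      rw [mul_pow]
      nlinarith [Real.sin_sq_le_one φ, sq_nonneg (Real.sin φ)]
    obtain ⟨δ, h1, h2⟩ := exists_eq_mul_cos_and_eq_mul_sin (x := Real.sin φ * q)
      (y := Real.cos φ) (R := √(1 - (s * Real.sin φ) ^ 2)) (Real.sqrt_nonneg _) (by
        rw [Real.sq_sqrt hle, mul_pow, hq]
        linear_combination Real.sin_sq_add_cos_sq φ)
    have e : ∀ ψ, G φ ψ = F (s * Real.sin φ) (ψ + δ) := by
      intro ψ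
      simp only [hG, hF]
      congr 1
      rw [Real.cos_add, Real.sin_add]
      set R := √(1 - (s * Real.sin φ) ^ 2)
      have c1 : Real.cos φ * (-Real.sin ψ) + Real.sin φ * q * Real.cos ψ =
          R * (Real.cos ψ * Real.cos δ - Real.sin ψ * Real.sin δ) := by
        rw [h1]; nth_rewrite 1 [h2]; ring
      have c2 : Real.cos φ * Real.cos ψ + Real.sin φ * q * Real.sin ψ =
          R * (Real.sin ψ * Real.cos δ + Real.cos ψ * Real.sin δ) := by
        rw [h1]; nth_rewrite 1 [h2]; ring
      rw [smul_add R, smul_smul R, smul_smul R, ← c1, ← c2]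
      module
    simp only [e]
    rw [intervalIntegral.integral_comp_add_right (F (s * Real.sin φ))]
    have hper : Function.Periodic (F (s * Real.sin φ)) (2 * Real.pi) := by
      intro ψ
      simp only [hF, Real.cos_add_two_pi, Real.sin_add_two_pi]
    have := hper.intervalIntegral_add_eq 0 δ
    rw [zero_add] at this
    rw [this, zero_add, add_comm δ]
  simp only [hrot]
  rw [MeasureTheory.intervalIntegral_intervalIntegral_swap]
  · rw [intervalIntegral.integral_congr (g := fun _ => 0), intervalIntegral.integral_zero]
    intro ψ _
    have hsc := Real.sin_sq_add_cos_sq ψ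
    apply h_int
    · exact K.add_mem (K.smul_mem _ ha) (K.smul_mem _ hb)
    · exact K.add_mem (K.smul_mem _ hp) (K.smul_mem _ (K.add_mem (K.smul_mem _ ha)
        (K.smul_mem _ hb)))
    · simp only [inner_add_left, inner_add_right, real_inner_smul_left, real_inner_smul_right, haa,
        hbb, hab, hba]
      linear_combination hsc
    · simp only [inner_add_left, inner_add_right, real_inner_smul_left, real_inner_smul_right, haa,
        hbb, hab, hba, hpp, hpa, hpb, hap, hbp]
      linear_combination q ^ 2 * hsc + hq
    · simp only [inner_add_left, inner_add_right, real_inner_smul_left, real_inner_smul_right, haa,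
        hbb, hab, hba, hap, hbp]
      ring
  · rw [Set.uIoc_of_le Real.pi_pos.le, Set.uIoc_of_le (by positivity)]
    exact (hGc.continuousOn.integrableOn_compact (isCompact_Icc.prod isCompact_Icc)).mono_set
      (Set.prod_mono Set.Ioc_subset_Icc_self Set.Ioc_subset_Icc_self)

/-- The integral of an even function over a half-circle is invariant under isometries of the
plane of this circle. -/
lemma integral_half_circle_comp_isometry {A B : V} {P : V → ℝ}
    (hP : ∀ θ : ℝ, P (-(Real.cos θ • A + Real.sin θ • B)) = P (Real.cos θ • A + Real.sin θ • B))
    {a b c d : ℝ} (hab : a ^ 2 + b ^ 2 = 1) (hcd : c ^ 2 + d ^ 2 = 1) (h : a * c + b * d = 0) :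
    ∫ θ in (0:ℝ)..Real.pi, P (Real.cos θ • (a • A + b • B) + Real.sin θ • (c • A + d • B)) =
      ∫ θ in (0:ℝ)..Real.pi, P (Real.cos θ • A + Real.sin θ • B) := by
  set Q : ℝ → ℝ := fun θ => P (Real.cos θ • A + Real.sin θ • B) with hQ
  have hper : Function.Periodic Q Real.pi := by
    intro θ
    simp only [hQ, Real.cos_add_pi, Real.sin_add_pi, ← hP θ]
    congr 1
    module
  obtain ⟨δ, h1, h2⟩ := exists_eq_mul_cos_and_eq_mul_sin (x := a) (y := b) zero_le_one (by simpa)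
  rw [one_mul] at h1 h2
  have hdet : (a * d - b * c - 1) * (a * d - b * c + 1) = 0 := by
    linear_combination (c ^ 2 + d ^ 2) * hab + hcd - (a * c + b * d) * h
  rcases mul_eq_zero.mp hdet with hd | hd
  · have hc' : c = -b := by linear_combination (-c) * hab + a * h - b * hd
    have hd' : d = a := by linear_combination (-d) * hab + b * h + a * hd
    have e : ∀ θ : ℝ, P (Real.cos θ • (a • A + b • B) + Real.sin θ • (c • A + d • B)) =
        Q (θ + δ) := by
      intro θ
      simp only [hQ, Real.cos_add, Real.sin_add]
      rw [hc', hd', ← h1, ← h2]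
      congr 1
      module
    simp only [e]
    rw [intervalIntegral.integral_comp_add_right Q, zero_add, add_comm Real.pi,
      hper.intervalIntegral_add_eq δ 0, zero_add]
  · have hc' : c = b := by linear_combination (-c) * hab + a * h - b * hd
    have hd' : d = -a := by linear_combination (-d) * hab + b * h + a * hd
    have e : ∀ θ : ℝ, P (Real.cos θ • (a • A + b • B) + Real.sin θ • (c • A + d • B)) =
        Q (δ - θ) := by
      intro θ
      simp only [hQ, Real.cos_sub, Real.sin_sub]
      rw [hc', hd', ← h1, ← h2]
      congr 1
      module
    simp only [e]
    rw [intervalIntegral.integral_comp_sub_left Q, sub_zero]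
    have := hper.intervalIntegral_add_eq (δ - Real.pi) 0
    rwa [sub_add_cancel, zero_add] at this

end Circle

lemma orthonormal_four {a b c d : E4} : Orthonormal ℝ ![a, b, c, d] ↔
    (⟪a, a⟫ = 1 ∧ ⟪b, b⟫ = 1 ∧ ⟪c, c⟫ = 1 ∧ ⟪d, d⟫ = 1) ∧ ⟪a, b⟫ = 0 ∧ ⟪a, c⟫ = 0 ∧ ⟪a, d⟫ = 0 ∧
      ⟪b, c⟫ = 0 ∧ ⟪b, d⟫ = 0 ∧ ⟪c, d⟫ = 0 := by
  rw [orthonormal_iff_ite]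
  constructor
  · intro h
    exact ⟨⟨h 0 0, h 1 1, h 2 2, h 3 3⟩, h 0 1, h 0 2, h 0 3, h 1 2, h 1 3, h 2 3⟩
  · rintro ⟨⟨h0, h1, h2, h3⟩, h01, h02, h03, h12, h13, h23⟩ i j
    fin_cases i <;> fin_cases j <;>
      simp [-inner_self_eq_norm_sq_to_K, real_inner_comm, *]

lemma exists_orthonormalBasis_eqOn {v : Fin 4 → E4} {s : Set (Fin 4)}
    (hv : ∀ i ∈ s, ∀ j ∈ s, ⟪v i, v j⟫ = if i = j then 1 else 0) :
    ∃ b : OrthonormalBasis (Fin 4) ℝ E4, ∀ i ∈ s, b i = v i := by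
  apply Orthonormal.exists_orthonormalBasis_extension_of_card_eq (by simp)
  rw [orthonormal_iff_ite]
  rintro ⟨i, hi⟩ ⟨j, hj⟩
  simpa [Subtype.ext_iff] using hv i hi j hj

lemma exists_orthonormal_four_of_pair {a b : E4} (ha : ⟪a, a⟫ = 1) (hb : ⟪b, b⟫ = 1)
    (hab : ⟪a, b⟫ = 0) : ∃ c d, Orthonormal ℝ ![a, b, c, d] := by
  have hba : ⟪b, a⟫ = 0 := by rw [real_inner_comm, hab]
  obtain ⟨e, he⟩ := exists_orthonormalBasis_eqOn (v := ![a, b, 0, 0]) (s := {0, 1}) (by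
    rintro i (rfl | rfl) j (rfl | rfl) <;> simp [-inner_self_eq_norm_sq_to_K, *])
  refine ⟨e 2, e 3, ?_⟩
  have : ![a, b, e 2, e 3] = e := by
    funext i
    fin_cases i <;> simp [he]
  exact this ▸ e.orthonormal

lemma exists_orthonormal_four_of_triple {a c d : E4} (ha : ⟪a, a⟫ = 1) (hc : ⟪c, c⟫ = 1)
    (hd : ⟪d, d⟫ = 1) (hac : ⟪a, c⟫ = 0) (had : ⟪a, d⟫ = 0) (hcd : ⟪c, d⟫ = 0) :
    ∃ b, Orthonormal ℝ ![a, b, c, d] := by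
  have hca : ⟪c, a⟫ = 0 := by rw [real_inner_comm, hac]
  have hda : ⟪d, a⟫ = 0 := by rw [real_inner_comm, had]
  have hdc : ⟪d, c⟫ = 0 := by rw [real_inner_comm, hcd]
  obtain ⟨e, he⟩ := exists_orthonormalBasis_eqOn (v := ![a, 0, c, d]) (s := {0, 2, 3}) (by
    rintro i (rfl | rfl | rfl) j (rfl | rfl | rfl) <;> simp [-inner_self_eq_norm_sq_to_K, *])
  refine ⟨e 1, ?_⟩
  have : ![a, e 1, c, d] = e := by
    funext i
    fin_cases i <;> simp [he]
  exact this ▸ e.orthonormal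

lemma Orthonormal.eq_sum_four {a b c d : E4} (h : Orthonormal ℝ ![a, b, c, d]) (x : E4) :
    x = ⟪a, x⟫ • a + ⟪b, x⟫ • b + ⟪c, x⟫ • c + ⟪d, x⟫ • d := by
  obtain ⟨e, he⟩ := exists_orthonormalBasis_eqOn (v := ![a, b, c, d]) (s := Set.univ)
    fun i _ j _ => orthonormal_iff_ite.mp h i j
  have := e.sum_repr' x
  rw [Fin.sum_univ_four] at this
  simpa [he] using this.symm

lemma mem_sph_iff {x : E4} : x ∈ sph ↔ ⟪x, x⟫ = 1 := by
  rw [sph, mem_sphere_zero_iff_norm, real_inner_self_eq_norm_sq,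
    pow_eq_one_iff_of_nonneg (norm_nonneg x) two_ne_zero]

lemma mem_S2_iff {w x : E4} : x ∈ S2 w ↔ ⟪x, x⟫ = 1 ∧ ⟪x, w⟫ = 0 := by
  rw [← mem_sph_iff]
  rfl

lemma smul_add_smul_mem_sph {ζ σ : E4} (hζ : ⟪ζ, ζ⟫ = 1) (hσ : ⟪σ, σ⟫ = 1) (hσζ : ⟪σ, ζ⟫ = 0)
    {r t : ℝ} (hrt : r ^ 2 + t ^ 2 = 1) : r • σ + t • ζ ∈ sph := by
  have hζσ : ⟪ζ, σ⟫ = 0 := by rw [real_inner_comm, hσζ]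
  rw [mem_sph_iff]
  simp only [inner_add_left, inner_add_right, real_inner_smul_left, real_inner_smul_right, hζ, hσ,
    hσζ, hζσ]
  linear_combination hrt

lemma apply_smul_neg_add_smul {ζ σ : E4} {f : E4 → ℝ} (hζ : ⟪ζ, ζ⟫ = 1)
    (hodd : ∀ θ ∈ sph, f (Ocal ζ θ) = -f θ) (hσ : ⟪σ, σ⟫ = 1) (hσζ : ⟪σ, ζ⟫ = 0) {r t : ℝ}
    (hrt : r ^ 2 + t ^ 2 = 1) : f (r • (-σ) + t • ζ) = -f (r • σ + t • ζ) := by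
  rw [← hodd _ (smul_add_smul_mem_sph hζ hσ hσζ hrt), Ocal, inner_add_left, real_inner_smul_left,
    real_inner_smul_left, hζ, hσζ]
  congr 1
  module

lemma inner_circle {A B : E4} (hA : ⟪A, A⟫ = 1) (hB : ⟪B, B⟫ = 1) (hAB : ⟪A, B⟫ = 0) (θ : ℝ) :
    ⟪Real.cos θ • A + Real.sin θ • B, Real.cos θ • A + Real.sin θ • B⟫ = 1 := by
  have hBA : ⟪B, A⟫ = 0 := by rw [real_inner_comm, hAB]
  simp only [inner_add_left, inner_add_right, real_inner_smul_left, real_inner_smul_right, hA, hB,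
    hAB, hBA]
  linear_combination Real.sin_sq_add_cos_sq θ

lemma inner_circle_eq_zero {A B ζ : E4} (hA : ⟪A, ζ⟫ = 0) (hB : ⟪B, ζ⟫ = 0) (θ : ℝ) :
    ⟪Real.cos θ • A + Real.sin θ • B, ζ⟫ = 0 := by
  rw [inner_add_left, real_inner_smul_left, real_inner_smul_left, hA, hB, mul_zero, mul_zero,
    add_zero]

/-- An isometry preserving two vectors of an orthonormal frame up to sign acts on the plane of
the two others. -/
lemma LinearIsometryEquiv.exists_plane_coords {φ : E4 ≃ₗᵢ[ℝ] E4} {ζ w A B : E4}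
    (h : Orthonormal ℝ ![ζ, w, A, B]) (hw : φ w = w) (hζ : φ ζ = ζ ∨ φ ζ = -ζ) :
    ∃ a b c d : ℝ, φ A = a • A + b • B ∧ φ B = c • A + d • B ∧ a ^ 2 + b ^ 2 = 1 ∧
      c ^ 2 + d ^ 2 = 1 ∧ a * c + b * d = 0 := by
  obtain ⟨⟨-, -, hA, hB⟩, -, hζA, hζB, hwA, hwB, hAB⟩ := orthonormal_four.mp h
  have hBA : ⟪B, A⟫ = 0 := by rw [real_inner_comm, hAB]
  have key : ∀ x, ⟪ζ, x⟫ = 0 → ⟪w, x⟫ = 0 → φ x = ⟪A, φ x⟫ • A + ⟪B, φ x⟫ • B := by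
    intro x h1 h2
    have e1 : ⟪ζ, φ x⟫ = 0 := by
      have := φ.inner_map_map ζ x
      rw [h1] at this
      rcases hζ with hζ | hζ <;> simpa [hζ] using this
    have e2 : ⟪w, φ x⟫ = 0 := by
      have := φ.inner_map_map w x
      rwa [hw, h2] at this
    have := h.eq_sum_four (φ x)
    rwa [e1, e2, zero_smul, zero_smul, zero_add, zero_add] at this
  have kA := key A hζA hwA
  have kB := key B hζB hwB
  have iAA := φ.inner_map_map A A
  have iBB := φ.inner_map_map B B
  have iAB := φ.inner_map_map A B
  generalize ⟪A, φ A⟫ = a at kA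
  generalize ⟪B, φ A⟫ = b at kA
  generalize ⟪A, φ B⟫ = c at kB
  generalize ⟪B, φ B⟫ = d at kB
  refine ⟨a, b, c, d, kA, kB, ?_, ?_, ?_⟩
  all_goals
    simp only [kA, kB, inner_add_left, inner_add_right, real_inner_smul_left,
      real_inner_smul_right, hA, hB, hAB, hBA] at iAA iBB iAB
  · linear_combination iAA
  · linear_combination iBB
  · linear_combination iAB

/-- Even symmetric expressions in the values of `f` and `g` at heights `±t` coincide. -/
lemma symm_comp_eq {ζ : E4} (hζ : ⟪ζ, ζ⟫ = 1) {f g : E4 → ℝ} (hf : Continuous f)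
    (hg : Continuous g) (hfodd : ∀ θ ∈ sph, f (Ocal ζ θ) = -f θ)
    (hrot : ∀ w ∈ S2 ζ, ∃ φ : E4 ≃ₗᵢ[ℝ] E4,
      IsRot w φ ∧ (φ ζ = ζ ∨ φ ζ = -ζ) ∧ ∀ θ ∈ S2 w, f (φ θ) = g θ)
    {Ψ : ℝ → ℝ → ℝ} (hΨ : Continuous (Function.uncurry Ψ)) (hsymm : ∀ x y, Ψ x y = Ψ y x)
    (hneg : ∀ x y, Ψ (-x) (-y) = Ψ x y) {r t : ℝ} (hrt : r ^ 2 + t ^ 2 = 1) {p : E4}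
    (hp : ⟪p, p⟫ = 1) (hpζ : ⟪p, ζ⟫ = 0) :
    Ψ (f (r • p + t • ζ)) (f (r • p + (-t) • ζ)) = Ψ (g (r • p + t • ζ)) (g (r • p + (-t) • ζ)) := by
  have hrt' : r ^ 2 + (-t) ^ 2 = 1 := by rwa [neg_sq]
  set D : (E4 → ℝ) → E4 → ℝ := fun f σ => Ψ (f (r • σ + t • ζ)) (f (r • σ + (-t) • ζ)) with hD
  have hDc : ∀ {f : E4 → ℝ}, Continuous f → Continuous (D f) := fun {f} hf =>
    hΨ.comp ((hf.comp (by fun_prop)).prodMk (hf.comp (by fun_prop)))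
  obtain ⟨a, b, hab⟩ := exists_orthonormal_four_of_pair hζ hp (by rw [real_inner_comm, hpζ])
  obtain ⟨⟨-, -, haa, hbb⟩, -, hζa, hζb, hpa, hpb, hab⟩ := orthonormal_four.mp hab
  have mem : ∀ x : E4, x ∈ (ℝ ∙ ζ)ᗮ ↔ ⟪ζ, x⟫ = 0 := fun x =>
    Submodule.mem_orthogonal_singleton_iff_inner_right
  refine sub_eq_zero.mp (eq_zero_of_integral_half_circle_eq_zero (ℝ ∙ ζ)ᗮ
    (h := fun σ => D f σ - D g σ) ((hDc hf).sub (hDc hg)) ?_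
    (p := p) (a := a) (b := b) ?_ ((mem a).mpr hζa) ((mem b).mpr hζb) hp haa hbb hpa hpb hab)
  swap
  · rw [mem, real_inner_comm, hpζ]
  intro A hA B hB hAA hBB hAB
  rw [mem] at hA hB
  have hAζ : ⟪A, ζ⟫ = 0 := by rw [real_inner_comm, hA]
  have hBζ : ⟪B, ζ⟫ = 0 := by rw [real_inner_comm, hB]
  obtain ⟨w, hw⟩ := exists_orthonormal_four_of_triple hζ hAA hBB hA hB hAB
  obtain ⟨⟨-, hww, -, -⟩, hζw, -, -, hwA, hwB, -⟩ := orthonormal_four.mp hw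
  obtain ⟨φ, ⟨hφw, -⟩, hφζ, hfg⟩ := hrot w (mem_S2_iff.mpr ⟨hww, by rw [real_inner_comm, hζw]⟩)
  obtain ⟨a, b, c, d, eA, eB, h1, h2, h3⟩ := LinearIsometryEquiv.exists_plane_coords hw hφw hφζ
  have hg_eq : ∀ θ : ℝ, D g (Real.cos θ • A + Real.sin θ • B) =
      D f (Real.cos θ • (a • A + b • B) + Real.sin θ • (c • A + d • B)) := by
    intro θ
    have hS : ∀ s : ℝ, r ^ 2 + s ^ 2 = 1 →
        r • (Real.cos θ • A + Real.sin θ • B) + s • ζ ∈ S2 w := by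
      intro s hs
      refine ⟨smul_add_smul_mem_sph hζ (inner_circle hAA hBB hAB θ)
        (inner_circle_eq_zero hAζ hBζ θ) hs, ?_⟩
      rw [real_inner_comm] at hwA hwB
      rw [inner_add_left, real_inner_smul_left, real_inner_smul_left,
        inner_circle_eq_zero hwA hwB, hζw, mul_zero, mul_zero, add_zero]
    simp only [hD]
    rw [← hfg _ (hS t hrt), ← hfg _ (hS (-t) hrt')]
    rcases hφζ with hφζ | hφζ
    · simp only [map_add, map_smul, eA, eB, hφζ]
    · simp only [map_add, map_smul, map_neg, eA, eB, hφζ, smul_neg, neg_smul, neg_neg]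
      rw [hsymm]
  have hDeven : ∀ θ : ℝ, D f (-(Real.cos θ • A + Real.sin θ • B)) =
      D f (Real.cos θ • A + Real.sin θ • B) := by
    intro θ
    simp only [hD]
    rw [apply_smul_neg_add_smul hζ hfodd (inner_circle hAA hBB hAB θ)
        (inner_circle_eq_zero hAζ hBζ θ) hrt, apply_smul_neg_add_smul hζ hfodd
        (inner_circle hAA hBB hAB θ) (inner_circle_eq_zero hAζ hBζ θ) hrt', hneg]
  have hDf := hDc hf
  have hDg := hDc hg
  rw [intervalIntegral.integral_sub (Continuous.intervalIntegrable (by fun_prop) _ _)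
    (Continuous.intervalIntegrable (by fun_prop) _ _)]
  simp only [hg_eq]
  rw [integral_half_circle_comp_isometry hDeven h1 h2 h3, sub_self]

lemma Function.Periodic.eq_of_irrational {P : ℝ → ℝ} (hP : Continuous P) {a b : ℝ}
    (ha : Function.Periodic P a) (hb : Function.Periodic P b) (hab : Irrational (a / b))
    (x y : ℝ) : P x = P y := by
  have hcl : ∀ T ∈ AddSubgroup.closure {a, b}, Function.Periodic P T := by
    intro T hT
    induction hT using AddSubgroup.closure_induction with
    | mem T hT =>
      rcases hT with rfl | rfl
      exacts [ha, hb]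
    | zero => exact fun x => by rw [add_zero]
    | add T U _ _ hT hU => exact hT.add_period hU
    | neg T _ hT => exact hT.neg
  have : P = fun _ => P 0 := by
    refine Continuous.ext_on (dense_addSubgroupClosure_pair_iff.mpr hab) hP continuous_const ?_
    intro T hT
    simpa using hcl T hT 0
  rw [this]

/-- If `u² + v²` and `u² v²` are constant and `u` has a zero then `u` vanishes identically. -/
lemma eq_zero_of_sq_add_sq_const {u v : ℝ → ℝ} (hu : Continuous u)
    (hadd : ∀ x y, u x ^ 2 + v x ^ 2 = u y ^ 2 + v y ^ 2)
    (hmul : ∀ x y, u x ^ 2 * v x ^ 2 = u y ^ 2 * v y ^ 2) {x₀ : ℝ} (h₀ : u x₀ = 0) (x : ℝ) :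
    u x = 0 := by
  have hprod : ∀ y, u y ^ 2 * v y ^ 2 = 0 := fun y => by rw [hmul y x₀, h₀]; ring
  by_contra hx
  have hv : v x ^ 2 = 0 := (mul_eq_zero.mp (hprod x)).resolve_left (pow_ne_zero 2 hx)
  have hpos : 0 < u x ^ 2 := by positivity
  obtain ⟨y, -, hy⟩ := intermediate_value_uIcc (a := x₀) (b := x)
    (f := fun y => u y ^ 2) (by fun_prop) (show u x ^ 2 / 2 ∈ Set.uIcc (u x₀ ^ 2) (u x ^ 2) by
      rw [h₀, Set.uIcc_of_le (by simpa using hpos.le)]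
      constructor <;> nlinarith)
  simp only at hy
  have h1 := hadd y x
  have h2 := hprod y
  have h3 : v y ^ 2 = u x ^ 2 / 2 := by linarith
  rw [hy, h3] at h2
  nlinarith

lemma eqOn_S2_of_continuous {ζ : E4} (hζ : ⟪ζ, ζ⟫ = 1) {f g : E4 → ℝ} (hf : Continuous f)
    (hg : Continuous g) (hfodd : ∀ θ ∈ sph, f (Ocal ζ θ) = -f θ)
    (hrot : ∀ w ∈ S2 ζ, ∃ φ : E4 ≃ₗᵢ[ℝ] E4,
      IsRot w φ ∧ (φ ζ = ζ ∨ φ ζ = -ζ) ∧ ∀ θ ∈ S2 w, f (φ θ) = g θ)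
    {α : ℝ} (hirr : Irrational α) {w : E4} (hw : w ∈ Xi f g ζ α) {θ : E4} (hθ : θ ∈ S2 w) :
    f θ = g θ := by
  obtain ⟨hwζ, φ, ⟨⟨hφw, -⟩, hφζ, hφα⟩, hfg⟩ := hw
  obtain ⟨hww, hwζ⟩ := mem_S2_iff.mp hwζ
  have hζw : ⟪ζ, w⟫ = 0 := by rw [real_inner_comm, hwζ]
  obtain ⟨A, B, hO⟩ := exists_orthonormal_four_of_pair hζ hww hζw
  obtain ⟨⟨-, -, hA, hB⟩, -, hζA, hζB, hwA, hwB, hAB⟩ := orthonormal_four.mp hO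
  have hBA : ⟪B, A⟫ = 0 := by rw [real_inner_comm, hAB]
  have hAζ : ⟪A, ζ⟫ = 0 := by rw [real_inner_comm, hζA]
  have hBζ : ⟪B, ζ⟫ = 0 := by rw [real_inner_comm, hζB]
  have hAw : ⟪A, w⟫ = 0 := by rw [real_inner_comm, hwA]
  have hBw : ⟪B, w⟫ = 0 := by rw [real_inner_comm, hwB]
  obtain ⟨a, b, c, d, eA, eB, h1, h2, -⟩ :=
    LinearIsometryEquiv.exists_plane_coords hO hφw (Or.inl hφζ)
  have ha := hφα A hAw hAζ
  have hd := hφα B hBw hBζ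
  have hbc := hφα (A + B) (by rw [inner_add_left, hAw, hBw, add_zero])
    (by rw [inner_add_left, hAζ, hBζ, add_zero])
  simp only [map_add, eA, eB, inner_add_left, inner_add_right, real_inner_smul_left, hA, hB, hAB,
    hBA] at ha hd hbc
  replace ha : a = Real.cos (α * Real.pi) := by linarith
  replace hd : d = Real.cos (α * Real.pi) := by linarith
  have hc : c = -b := by linarith
  obtain ⟨τ, hτ, hcos, hsin⟩ : ∃ τ : ℝ, (τ = α * Real.pi ∨ τ = -(α * Real.pi)) ∧
      Real.cos τ = a ∧ Real.sin τ = b := by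
    have hb : b ^ 2 = Real.sin (α * Real.pi) ^ 2 := by
      rw [Real.sin_sq, ← ha]
      linarith
    rcases sq_eq_sq_iff_eq_or_eq_neg.mp hb with hb | hb
    · exact ⟨_, Or.inl rfl, ha.symm, hb.symm⟩
    · exact ⟨_, Or.inr rfl, by rw [Real.cos_neg, ha], by rw [Real.sin_neg, hb]⟩
  set γ : ℝ → E4 := fun θ => Real.cos θ • A + Real.sin θ • B with hγ
  have hγc : Continuous γ := by fun_prop
  have hγ1 : ∀ θ, ⟪γ θ, γ θ⟫ = 1 := inner_circle hA hB hAB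
  have hγζ : ∀ θ, ⟪γ θ, ζ⟫ = 0 := inner_circle_eq_zero hAζ hBζ
  have hγpi : ∀ θ, γ (θ + Real.pi) = -γ θ := by
    intro θ
    simp only [hγ, Real.cos_add_pi, Real.sin_add_pi]
    module
  have hφγ : ∀ θ, φ (γ θ) = γ (θ + τ) := by
    intro θ
    simp only [hγ, map_add, map_smul, eA, eB, Real.cos_add, Real.sin_add, hcos, hsin, hc, hd, ← ha]
    module
  have hfφ : ∀ θ r t : ℝ, r ^ 2 + t ^ 2 = 1 → g (r • γ θ + t • ζ) = f (r • γ (θ + τ) + t • ζ) := by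
    intro θ r t hrt
    rw [← hfg, map_add, map_smul, map_smul, hφγ, hφζ]
    refine ⟨smul_add_smul_mem_sph hζ (hγ1 θ) (hγζ θ) hrt, ?_⟩
    rw [inner_add_left, real_inner_smul_left, real_inner_smul_left,
      inner_circle_eq_zero hAw hBw, hζw, mul_zero, mul_zero, add_zero]
  have hconst : ∀ {Ψ : ℝ → ℝ → ℝ}, Continuous (Function.uncurry Ψ) → (∀ x y, Ψ x y = Ψ y x) →
      (∀ x y, Ψ (-x) (-y) = Ψ x y) → ∀ {r t : ℝ}, r ^ 2 + t ^ 2 = 1 → ∀ x y : ℝ,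
      Ψ (f (r • γ x + t • ζ)) (f (r • γ x + (-t) • ζ)) =
        Ψ (f (r • γ y + t • ζ)) (f (r • γ y + (-t) • ζ)) := by
    intro Ψ hΨ hsymm hneg r t hrt
    have hrt' : r ^ 2 + (-t) ^ 2 = 1 := by rwa [neg_sq]
    set P : ℝ → ℝ := fun x => Ψ (f (r • γ x + t • ζ)) (f (r • γ x + (-t) • ζ)) with hP
    have hPc : Continuous P :=
      hΨ.comp ((hf.comp (by fun_prop)).prodMk (hf.comp (by fun_prop)))
    have hPpi : Function.Periodic P Real.pi := by
      intro x
      simp only [hP, hγpi]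
      rw [apply_smul_neg_add_smul hζ hfodd (hγ1 x) (hγζ x) hrt,
        apply_smul_neg_add_smul hζ hfodd (hγ1 x) (hγζ x) hrt', hneg]
    have hPτ : Function.Periodic P τ := by
      intro x
      simp only [hP]
      rw [← hfφ x r t hrt, ← hfφ x r (-t) hrt']
      exact (symm_comp_eq hζ hf hg hfodd hrot hΨ hsymm hneg hrt (hγ1 x) (hγζ x)).symm
    have hPα : Function.Periodic P (α * Real.pi) := by
      rcases hτ with hτ | hτ
      · rwa [← hτ]
      · rw [← neg_neg (α * Real.pi), ← hτ]
        exact hPτ.neg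
    refine hPα.eq_of_irrational hPc hPpi ?_
    rwa [mul_div_cancel_right₀ _ Real.pi_ne_zero]
  have hzero : ∀ {r t : ℝ}, r ^ 2 + t ^ 2 = 1 → ∀ x : ℝ, f (r • γ x + t • ζ) = 0 := by
    intro r t hrt
    set u : ℝ → ℝ := fun x => f (r • γ x + t • ζ) with hu
    have huc : Continuous u := by fun_prop
    have hpi : u Real.pi = -u 0 := by
      simp only [hu]
      rw [← zero_add Real.pi, hγpi, apply_smul_neg_add_smul hζ hfodd (hγ1 0) (hγζ 0) hrt]
    obtain ⟨x₀, -, hx₀⟩ := intermediate_value_uIcc (a := 0) (b := Real.pi) huc.continuousOn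
      (show (0 : ℝ) ∈ Set.uIcc (u 0) (u Real.pi) by
        rw [hpi, Set.mem_uIcc]
        rcases le_total (u 0) 0 with h | h
        · exact Or.inl ⟨h, by linarith⟩
        · exact Or.inr ⟨by linarith, h⟩)
    refine eq_zero_of_sq_add_sq_const huc (v := fun x => f (r • γ x + (-t) • ζ)) ?_ ?_ hx₀
    · exact hconst (Ψ := fun x y => x ^ 2 + y ^ 2) (by unfold Function.uncurry; fun_prop)
        (fun x y => by ring) (fun x y => by ring) hrt
    · exact hconst (Ψ := fun x y => x ^ 2 * y ^ 2) (by unfold Function.uncurry; fun_prop)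
        (fun x y => by ring) (fun x y => by ring) hrt
  have hf0 : ∀ x ∈ S2 w, f x = 0 := by
    intro x hx
    obtain ⟨hxx, hxw⟩ := mem_S2_iff.mp hx
    have hsum := hO.eq_sum_four x
    rw [real_inner_comm x w, hxw, zero_smul, add_zero] at hsum
    generalize ⟪ζ, x⟫ = t at hsum
    generalize ⟪A, x⟫ = a' at hsum
    generalize ⟪B, x⟫ = b' at hsum
    obtain ⟨δ, e1, e2⟩ := exists_eq_mul_cos_and_eq_mul_sin (x := a') (y := b')
      (Real.sqrt_nonneg (a' ^ 2 + b' ^ 2)) (by rw [Real.sq_sqrt (by positivity)])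
    set r := √(a' ^ 2 + b' ^ 2)
    have hx' : x = r • γ δ + t • ζ := by
      rw [hsum, e1, e2]
      module
    have hrt : r ^ 2 + t ^ 2 = 1 := by
      have hζγ : ⟪ζ, γ δ⟫ = 0 := by rw [real_inner_comm, hγζ]
      rw [hx'] at hxx
      simp only [inner_add_left, inner_add_right, real_inner_smul_left, real_inner_smul_right, hζ,
        hγ1, hγζ, hζγ] at hxx
      linear_combination hxx
    rw [hx', hzero hrt]
  rw [← hfg θ hθ, hf0 θ hθ, hf0 _ ?_]
  rw [mem_S2_iff, φ.inner_map_map, ← hφw, φ.inner_map_map]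
  exact mem_S2_iff.mp hθ

lemma exists_continuous_eqOn_sph {f : E4 → ℝ} (hf : ContinuousOn f sph) :
    ∃ F : E4 → ℝ, Continuous F ∧ Set.EqOn F f sph := by
  obtain ⟨F, hF⟩ := ContinuousMap.exists_restrict_eq
    (Metric.isClosed_sphere (x := (0 : E4)) (ε := 1))
    ⟨sph.domRestrict f, hf.domRestrict⟩
  exact ⟨F, F.continuous, fun x hx => DFunLike.congr_fun hF ⟨x, hx⟩⟩

lemma Ocal_mem_sph {ζ x : E4} (hζ : ζ ∈ sph) (hx : x ∈ sph) : Ocal ζ x ∈ sph := by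
  rw [mem_sph_iff] at *
  have := real_inner_comm x ζ
  simp only [Ocal, inner_sub_left, inner_sub_right, real_inner_smul_left, real_inner_smul_right, hζ,
    hx, this]
  ring

/-- Lemma: for irrational `α ∈ [0,2]`, `Ξ_α ⊆ Ξ₀`. -/
theorem stmt_4 (ζ : E4) (hζ : ζ ∈ sph) (f g : E4 → ℝ)
    (hf : ContinuousOn f sph) (hg : ContinuousOn g sph)
    (hfodd : ∀ θ ∈ sph, f (Ocal ζ θ) = - f θ)
    (hgodd : ∀ θ ∈ sph, g (Ocal ζ θ) = - g θ)
    (hrot : ∀ w ∈ S2 ζ, ∃ φ : E4 ≃ₗᵢ[ℝ] E4,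
      IsRot w φ ∧ (φ ζ = ζ ∨ φ ζ = -ζ) ∧ ∀ θ ∈ S2 w, f (φ θ) = g θ)
    (α : ℝ) (hα : α ∈ Set.Icc (0:ℝ) 2) (hirr : Irrational α) :
    ∀ w ∈ Xi f g ζ α, ∀ θ ∈ S2 w, f θ = g θ := by
  intro w hw θ hθ
  obtain ⟨F, hFc, hF⟩ := exists_continuous_eqOn_sph hf
  obtain ⟨G, hGc, hG⟩ := exists_continuous_eqOn_sph hg
  have hmap : ∀ (φ : E4 ≃ₗᵢ[ℝ] E4) {x : E4}, x ∈ sph → φ x ∈ sph := by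
    intro φ x hx
    rwa [mem_sph_iff, φ.inner_map_map, ← mem_sph_iff]
  have hFG : ∀ {w : E4} {φ : E4 ≃ₗᵢ[ℝ] E4}, (∀ θ ∈ S2 w, f (φ θ) = g θ) →
      ∀ θ ∈ S2 w, F (φ θ) = G θ := by
    intro w φ h θ hθ
    rw [hF (hmap φ hθ.1), hG hθ.1, h θ hθ]
  rw [← hF hθ.1, ← hG hθ.1]
  refine eqOn_S2_of_continuous (mem_sph_iff.mp hζ) hFc hGc ?_ ?_ hirr ?_ hθ
  · intro x hx
    rw [hF (Ocal_mem_sph hζ hx), hF hx, hfodd x hx]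
  · intro w hw
    obtain ⟨φ, h1, h2, h3⟩ := hrot w hw
    exact ⟨φ, h1, h2, hFG h3⟩
  · obtain ⟨h1, φ, h2, h3⟩ := hw
    exact ⟨h1, φ, h2, hFG h3⟩
end
end

section
/- Let f and g be continuous real-valued functions on S³, odd with respect to 𝒪, and let ζ ∈ S³. Suppose U ⊆ S²(ζ) is a nonempty open spherical cap with U ⊆ Ξ_{p/q} for some rational number p/q ∈ (0,1). Then f = g = 0 on S²(w) for every w ∈ U. -/
noncomputable section

open scoped RealInnerProductSpace

section

open Matrix Filter Topology

theorem continuous_cross {X : Type*} [TopologicalSpace X] {a b : X → Fin 3 → ℝ}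
    (ha : Continuous a) (hb : Continuous b) : Continuous fun x => a x ⨯₃ b x := by
  refine continuous_pi fun i => ?_
  fin_cases i <;> simp [cross_apply] <;> fun_prop

theorem dotProduct_self_pos_of_ne_zero {y : Fin 3 → ℝ} (hy : y ≠ 0) : 0 < y ⬝ᵥ y := by
  simpa using dotProduct_star_self_pos_iff.2 hy

theorem cross_cross_eq_smul_sub_smul_right (a b d : Fin 3 → ℝ) :
    a ⨯₃ (b ⨯₃ d) = (a ⬝ᵥ d) • b - (a ⬝ᵥ b) • d := by
  ext i
  fin_cases i <;> simp [cross_apply, vec3_dotProduct] <;> ring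

theorem dotProduct_rotation {c s : ℝ} (hcs : c ^ 2 + s ^ 2 = 1) {w y : Fin 3 → ℝ}
    (hw : w ⬝ᵥ w = 1) (hyw : y ⬝ᵥ w = 0) :
    (c • y + s • (w ⨯₃ y)) ⬝ᵥ (c • y + s • (w ⨯₃ y)) = y ⬝ᵥ y := by
  have h1 : (w ⨯₃ y) ⬝ᵥ (w ⨯₃ y) = y ⬝ᵥ y := by
    rw [cross_dot_cross, hw, hyw, dotProduct_comm w, hyw]; ring
  simp only [add_dotProduct, smul_dotProduct, dotProduct_add, dotProduct_smul, h1,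
    dot_cross_self, dotProduct_comm (w ⨯₃ y) y, smul_eq_mul]
  linear_combination (y ⬝ᵥ y) * hcs

/-- If `ω` is a unit vector at angle `arccos c` from the unit vector `θ`, then `θ` is the image of
`ω` under the rotation about `s⁻¹ (ω × θ)`. -/
theorem rotation_about_cross_eq {c s : ℝ} (hcs : c ^ 2 + s ^ 2 = 1) (hs : s ≠ 0)
    {F G : (Fin 3 → ℝ) → ℝ} {O : Set (Fin 3 → ℝ)}
    (hP : ∀ w ∈ O, w ⬝ᵥ w = 1 → ∀ y, y ≠ 0 → y ⬝ᵥ w = 0 → F (c • y + s • (w ⨯₃ y)) = G y)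
    {θ ω : Fin 3 → ℝ} (hθ : θ ⬝ᵥ θ = 1) (hω : ω ⬝ᵥ ω = 1) (hωθ : ω ⬝ᵥ θ = c)
    (hO : s⁻¹ • (ω ⨯₃ θ) ∈ O) : F θ = G ω := by
  have h1 : (s⁻¹ • (ω ⨯₃ θ)) ⬝ᵥ (s⁻¹ • (ω ⨯₃ θ)) = 1 := by
    rw [smul_dotProduct, dotProduct_smul, cross_dot_cross, hθ, hω, dotProduct_comm θ, hωθ]
    have : (1 : ℝ) * 1 - c * c = s * s := by linarith
    simp only [smul_eq_mul, this]
    field_simp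
  have h2 : ω ⬝ᵥ (s⁻¹ • (ω ⨯₃ θ)) = 0 := by
    rw [dotProduct_smul, dot_self_cross, smul_zero]
  have h0 : ω ≠ 0 := by
    rintro rfl
    simp at hω
  rw [← hP _ hO h1 ω h0 h2]
  congr 1
  simp only [vec3_dotProduct, Fin.isValue] at hω hωθ
  have key : ((ω ⨯₃ θ) ⨯₃ ω) = θ - c • ω := by
    rw [← hωθ]
    ext i
    fin_cases i <;> simp [cross_apply]
    · linear_combination (θ 0) * hω
    · linear_combination (θ 1) * hω
    · linear_combination (θ 2) * hω
  rw [map_smul, LinearMap.smul_apply, key, smul_smul, mul_inv_cancel₀ hs, one_smul]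
  simp

/-- A vector of inner product `c` with both `θ` and `η`. -/
def equiangular (c s : ℝ) (η θ : Fin 3 → ℝ) : Fin 3 → ℝ :=
  (c / (1 + θ ⬝ᵥ η)) • (θ + η) +
    (s * √((1 + θ ⬝ᵥ η - 2 * c ^ 2) / (s ^ 2 * (1 - θ ⬝ᵥ η) * (1 + θ ⬝ᵥ η) ^ 2))) • (θ ⨯₃ η)

theorem equiangular_spec {c s : ℝ} (hs : s ≠ 0) {η θ : Fin 3 → ℝ}
    (hη : η ⬝ᵥ η = 1) (hθ : θ ⬝ᵥ θ = 1) (h1 : θ ⬝ᵥ η < 1) (h2 : -1 < θ ⬝ᵥ η)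
    (h3 : 2 * c ^ 2 < 1 + θ ⬝ᵥ η) :
    equiangular c s η θ ⬝ᵥ θ = c ∧ equiangular c s η θ ⬝ᵥ η = c ∧
      equiangular c s η θ ⬝ᵥ equiangular c s η θ = 1 := by
  unfold equiangular
  have hcr1 : (θ ⨯₃ η) ⬝ᵥ θ = 0 := by rw [dotProduct_comm, dot_self_cross]
  have hcr2 : (θ ⨯₃ η) ⬝ᵥ η = 0 := by rw [dotProduct_comm, dot_cross_self]
  have hηθ : η ⬝ᵥ θ = θ ⬝ᵥ η := dotProduct_comm _ _
  have hcr3 : (θ ⨯₃ η) ⬝ᵥ (θ ⨯₃ η) = 1 - (θ ⬝ᵥ η) ^ 2 := by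
    rw [cross_dot_cross, hθ, hη, hηθ]; ring
  set d := θ ⬝ᵥ η with hd
  have hp : 1 + d ≠ 0 := by linarith
  have hm : 1 - d ≠ 0 := by linarith
  have hsq : √((1 + d - 2 * c ^ 2) / (s ^ 2 * (1 - d) * (1 + d) ^ 2)) ^ 2
      = (1 + d - 2 * c ^ 2) / (s ^ 2 * (1 - d) * (1 + d) ^ 2) := by
    apply Real.sq_sqrt
    have : 0 < 1 - d := by linarith
    have : 0 < 1 + d - 2 * c ^ 2 := by linarith
    positivity
  set k := √((1 + d - 2 * c ^ 2) / (s ^ 2 * (1 - d) * (1 + d) ^ 2))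
  refine ⟨?_, ?_, ?_⟩
  · simp only [add_dotProduct, smul_dotProduct, hcr1, hθ, hηθ, smul_eq_mul]
    field_simp; ring
  · simp only [add_dotProduct, smul_dotProduct, hcr2, hη, ← hd, smul_eq_mul]
    field_simp; ring
  · have hcr1' : θ ⬝ᵥ (θ ⨯₃ η) = 0 := dot_self_cross _ _
    have hcr2' : η ⬝ᵥ (θ ⨯₃ η) = 0 := dot_cross_self _ _
    simp only [add_dotProduct, smul_dotProduct, dotProduct_add, dotProduct_smul, hcr1, hcr2,
      hcr1', hcr2', hcr3, hθ, hη, hηθ, ← hd, smul_eq_mul]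
    have : s * k * (s * k * (1 - d ^ 2)) = s ^ 2 * (1 - d ^ 2) * k ^ 2 := by ring
    simp only [mul_zero, add_zero, zero_add, this, hsq]
    field_simp
    ring

theorem continuousAt_equiangular {c s : ℝ} (hs : s ≠ 0) {η θ : Fin 3 → ℝ}
    (h1 : θ ⬝ᵥ η < 1) (h2 : -1 < θ ⬝ᵥ η) : ContinuousAt (equiangular c s η) θ := by
  have hc : Continuous fun θ : Fin 3 → ℝ => θ ⬝ᵥ η := by fun_prop
  have hx : Continuous fun θ : Fin 3 → ℝ => θ ⨯₃ η :=
    continuous_cross continuous_id continuous_const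
  have hp : 1 + θ ⬝ᵥ η ≠ 0 := by linarith
  have hm : 1 - θ ⬝ᵥ η ≠ 0 := by linarith
  unfold equiangular
  have hadd : Continuous fun θ : Fin 3 → ℝ => θ + η := by fun_prop
  refine ContinuousAt.add (ContinuousAt.fun_smul ?_ hadd.continuousAt)
    (ContinuousAt.fun_smul ?_ hx.continuousAt)
  · exact ContinuousAt.div (by fun_prop) (by fun_prop) hp
  · refine continuousAt_const.mul (ContinuousAt.sqrt (ContinuousAt.div (by fun_prop) (by fun_prop) ?_))
    positivity

theorem exists_equiangular_mem {c s : ℝ} (hcs : c ^ 2 + s ^ 2 = 1) (hs : s ≠ 0)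
    {O : Set (Fin 3 → ℝ)} (hO : IsOpen O) {θ w : Fin 3 → ℝ} (hθ : θ ⬝ᵥ θ = 1) (hw : w ⬝ᵥ w = 1)
    (hθw : θ ⬝ᵥ w = 0) (hwO : w ∈ O) :
    ∃ η : Fin 3 → ℝ, η ⬝ᵥ η = 1 ∧ θ ⬝ᵥ η < 1 ∧ -1 < θ ⬝ᵥ η ∧ 2 * c ^ 2 < 1 + θ ⬝ᵥ η ∧
      s⁻¹ • (equiangular c s η θ ⨯₃ θ) ∈ O ∧ s⁻¹ • (equiangular c s η θ ⨯₃ η) ∈ O := by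
  let η : ℝ → Fin 3 → ℝ := fun m => ((1 - m ^ 2) / (1 + m ^ 2)) • θ + (2 * m / (1 + m ^ 2)) • w
  let ω : ℝ → Fin 3 → ℝ := fun m =>
    c • θ + (c * m) • w + (s * √(1 - c ^ 2 * m ^ 2 / s ^ 2)) • (θ ⨯₃ w)
  have hηc : Continuous η := by
    have : ∀ m : ℝ, 1 + m ^ 2 ≠ 0 := fun m => by positivity
    fun_prop (disch := assumption)
  have hωc : Continuous ω := by fun_prop
  have hη0 : η 0 = θ := by simp [η]
  have hcc : (θ ⨯₃ w) ⨯₃ θ = w := by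
    simp only [vec3_dotProduct, Fin.isValue] at hθ hθw
    ext i
    fin_cases i <;> simp [cross_apply]
    · linear_combination (w 0) * hθ - (θ 0) * hθw
    · linear_combination (w 1) * hθ - (θ 1) * hθw
    · linear_combination (w 2) * hθ - (θ 2) * hθw
  have hω0 : s⁻¹ • (ω 0 ⨯₃ θ) = w := by
    simp [ω, hcc, cross_self, smul_smul, hs]
  have e1 : ∀ᶠ m in 𝓝 (0 : ℝ), s⁻¹ • (ω m ⨯₃ θ) ∈ O :=
    ((continuous_cross hωc (continuous_const (y := θ))).const_smul s⁻¹).continuousAt.eventually_mem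
      (hO.mem_nhds (by simpa [hω0] using hwO))
  have e2 : ∀ᶠ m in 𝓝 (0 : ℝ), s⁻¹ • (ω m ⨯₃ η m) ∈ O :=
    ((continuous_cross hωc hηc).const_smul s⁻¹).continuousAt.eventually_mem
      (hO.mem_nhds (by simpa [hω0, hη0] using hwO))
  have e3 : ∀ᶠ m in 𝓝 (0 : ℝ), c ^ 2 * m ^ 2 < s ^ 2 := by
    have : Continuous fun m : ℝ => c ^ 2 * m ^ 2 := by fun_prop
    refine this.continuousAt.eventually_lt continuousAt_const ?_
    simp only [ne_eq, OfNat.ofNat_ne_zero, not_false_eq_true, zero_pow, mul_zero]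
    positivity
  obtain ⟨m, ⟨h1, h2, h3⟩, hm⟩ :=
    (((e1.and (e2.and e3)).filter_mono nhdsWithin_le_nhds).and
      (self_mem_nhdsWithin (s := Set.Ioi (0 : ℝ)))).exists
  have hm : 0 < m := hm
  have hd : θ ⬝ᵥ η m = (1 - m ^ 2) / (1 + m ^ 2) := by
    simp [η, hθ, hθw]
  have hsqrt : √((1 + θ ⬝ᵥ η m - 2 * c ^ 2) / (s ^ 2 * (1 - θ ⬝ᵥ η m) * (1 + θ ⬝ᵥ η m) ^ 2))
      = √(1 - c ^ 2 * m ^ 2 / s ^ 2) * ((1 + m ^ 2) / (2 * m)) := by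
    have hpos : (0 : ℝ) ≤ (1 + m ^ 2) / (2 * m) := by positivity
    rw [← Real.sqrt_sq hpos, ← Real.sqrt_mul, hd]
    · congr 1
      have hc : c ^ 2 = 1 - s ^ 2 := by linarith
      rw [hc]
      have ha : 1 - (1 - m ^ 2) / (1 + m ^ 2) = 2 * m ^ 2 / (1 + m ^ 2) := by field_simp; ring
      have hb : 1 + (1 - m ^ 2) / (1 + m ^ 2) = 2 / (1 + m ^ 2) := by field_simp; ring
      rw [ha, hb]
      field_simp
      ring
    · rw [sub_nonneg, div_le_one (by positivity)]
      exact h3.le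
  have hωm : equiangular c s (η m) θ = ω m := by
    unfold equiangular
    rw [hsqrt]
    have hb : 1 + θ ⬝ᵥ η m = 2 / (1 + m ^ 2) := by rw [hd]; field_simp; ring
    have hx : θ ⨯₃ η m = (2 * m / (1 + m ^ 2)) • (θ ⨯₃ w) := by
      simp [η, cross_self]
    rw [hb, hx, smul_smul]
    simp only [ω]
    congr 1
    · simp only [η]
      match_scalars <;> field_simp
      ring
    · congr 1
      field_simp
  refine ⟨η m, ?_, ?_, ?_, ?_, ?_, ?_⟩
  · simp only [η, add_dotProduct, smul_dotProduct, dotProduct_add, dotProduct_smul, hθ, hw, hθw,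
      dotProduct_comm w θ, smul_eq_mul]
    field_simp
    ring
  · rw [hd, div_lt_one (by positivity)]
    nlinarith
  · rw [hd, lt_div_iff₀ (by positivity)]
    nlinarith
  · have hb : 1 + θ ⬝ᵥ η m = 2 / (1 + m ^ 2) := by rw [hd]; field_simp; ring
    rw [hb, lt_div_iff₀ (by positivity)]
    nlinarith
  · rwa [hωm]
  · rwa [hωm]

/-- Local constancy on the sphere of a function whose rotations about an open set of axes
agree with a fixed function. -/
theorem eventually_eq_of_rotation {c s : ℝ} (hcs : c ^ 2 + s ^ 2 = 1) (hs : s ≠ 0)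
    {F G : (Fin 3 → ℝ) → ℝ} {O : Set (Fin 3 → ℝ)} (hO : IsOpen O)
    (hP : ∀ w ∈ O, w ⬝ᵥ w = 1 → ∀ y, y ≠ 0 → y ⬝ᵥ w = 0 → F (c • y + s • (w ⨯₃ y)) = G y)
    {θ w : Fin 3 → ℝ} (hθ : θ ⬝ᵥ θ = 1) (hw : w ⬝ᵥ w = 1) (hθw : θ ⬝ᵥ w = 0) (hwO : w ∈ O) :
    ∀ᶠ x in 𝓝 θ, x ⬝ᵥ x = 1 → F x = F θ := by
  obtain ⟨η, hη, h1, h2, h3, h4, h5⟩ := exists_equiangular_mem hcs hs hO hθ hw hθw hwO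
  have hc : Continuous fun θ : Fin 3 → ℝ => θ ⬝ᵥ η := by fun_prop
  have hcross : Continuous fun p : (Fin 3 → ℝ) × (Fin 3 → ℝ) => s⁻¹ • (p.1 ⨯₃ p.2) :=
    (continuous_cross continuous_fst continuous_snd).fun_const_smul _
  have hE := continuousAt_equiangular (c := c) hs h1 h2
  have e1 := hc.continuousAt.eventually_lt continuousAt_const h1
  have e2 := continuousAt_const.eventually_lt hc.continuousAt h2
  have e3 := continuousAt_const.eventually_lt
    ((continuous_const (y := (1 : ℝ))).add hc).continuousAt h3
  have e4 : ∀ᶠ x in 𝓝 θ, s⁻¹ • (equiangular c s η x ⨯₃ x) ∈ O :=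
    (ContinuousAt.comp (f := fun x => (equiangular c s η x, x)) hcross.continuousAt
      (hE.prodMk continuousAt_id)).eventually_mem (hO.mem_nhds h4)
  have e5 : ∀ᶠ x in 𝓝 θ, s⁻¹ • (equiangular c s η x ⨯₃ η) ∈ O :=
    (ContinuousAt.comp (f := fun x => (equiangular c s η x, η)) hcross.continuousAt
      (hE.prodMk continuousAt_const)).eventually_mem (hO.mem_nhds h5)
  have key : ∀ᶠ x in 𝓝 θ, x ⬝ᵥ x = 1 → F x = F η := by
    filter_upwards [e1, e2, e3, e4, e5] with x h1 h2 h3 h4 h5 hx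
    obtain ⟨a, b, d⟩ := equiangular_spec hs hη hx h1 h2 h3
    rw [rotation_about_cross_eq hcs hs hP hx d a h4, rotation_about_cross_eq hcs hs hP hη d b h5]
  have hθη := key.self_of_nhds hθ
  filter_upwards [key] with x hx h
  rw [hx h, hθη]

theorem eq_zero_of_rotation_of_unit {c s : ℝ} (hcs : c ^ 2 + s ^ 2 = 1) (hs : s ≠ 0)
    {F G : (Fin 3 → ℝ) → ℝ} (hodd : ∀ y, y ≠ 0 → F (-y) = -F y)
    {O : Set (Fin 3 → ℝ)} (hO : IsOpen O)
    (hP : ∀ w ∈ O, w ⬝ᵥ w = 1 → ∀ y, y ≠ 0 → y ⬝ᵥ w = 0 → F (c • y + s • (w ⨯₃ y)) = G y)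
    {θ w : Fin 3 → ℝ} (hθ : θ ⬝ᵥ θ = 1) (hw : w ⬝ᵥ w = 1) (hθw : θ ⬝ᵥ w = 0) (hwO : w ∈ O) :
    F θ = 0 := by
  let γ : ℝ → Fin 3 → ℝ := fun t => Real.cos t • θ + Real.sin t • (w ⨯₃ θ)
  have hγ : Continuous γ := by fun_prop
  have hcc : (w ⨯₃ θ) ⬝ᵥ (w ⨯₃ θ) = 1 := by
    rw [cross_dot_cross, hw, hθ, hθw, dotProduct_comm w, hθw]; ring
  have hc1 : θ ⬝ᵥ (w ⨯₃ θ) = 0 := dot_cross_self _ _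
  have hc2 : w ⬝ᵥ (w ⨯₃ θ) = 0 := dot_self_cross _ _
  have hγ1 : ∀ t, γ t ⬝ᵥ γ t = 1 := by
    intro t
    simp only [γ, add_dotProduct, smul_dotProduct, dotProduct_add, dotProduct_smul, hθ, hcc, hc1,
      dotProduct_comm (w ⨯₃ θ) θ, smul_eq_mul]
    linear_combination Real.cos_sq_add_sin_sq t
  have hγw : ∀ t, γ t ⬝ᵥ w = 0 := by
    intro t
    simp only [γ, add_dotProduct, smul_dotProduct, hθw, dotProduct_comm (w ⨯₃ θ) w, hc2]
    simp
  have hloc : IsLocallyConstant fun t => F (γ t) := by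
    rw [IsLocallyConstant.iff_eventually_eq]
    intro t
    have := eventually_eq_of_rotation hcs hs hO hP (hγ1 t) hw (hγw t) hwO
    filter_upwards [hγ.continuousAt.eventually this] with u hu using hu (hγ1 u)
  have h := hloc.apply_eq_of_preconnectedSpace Real.pi 0
  have hθ0 : θ ≠ 0 := by rintro rfl; simp at hθ
  simp only [γ, Real.cos_pi, Real.sin_pi, Real.cos_zero, Real.sin_zero, zero_smul, add_zero,
    one_smul, neg_smul, hodd θ hθ0] at h
  linarith

theorem eq_zero_of_rotation {c s : ℝ} (hcs : c ^ 2 + s ^ 2 = 1) (hs : s ≠ 0)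
    {F G : (Fin 3 → ℝ) → ℝ} (hodd : ∀ y, y ≠ 0 → F (-y) = -F y)
    {O : Set (Fin 3 → ℝ)} (hO : IsOpen O)
    (hP : ∀ w ∈ O, w ⬝ᵥ w = 1 → ∀ y, y ≠ 0 → y ⬝ᵥ w = 0 → F (c • y + s • (w ⨯₃ y)) = G y)
    {θ w : Fin 3 → ℝ} (hθ : θ ≠ 0) (hw : w ⬝ᵥ w = 1) (hθw : θ ⬝ᵥ w = 0) (hwO : w ∈ O) :
    F θ = 0 := by
  have hpos : 0 < θ ⬝ᵥ θ := dotProduct_self_pos_of_ne_zero hθ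
  set r := √(θ ⬝ᵥ θ) with hr
  have hr0 : r ≠ 0 := (Real.sqrt_pos.2 hpos).ne'
  have hr2 : r ^ 2 = θ ⬝ᵥ θ := Real.sq_sqrt hpos.le
  have := eq_zero_of_rotation_of_unit (F := fun y => F (r • y)) (G := fun y => G (r • y))
    hcs hs (fun y hy => by simpa using hodd (r • y) (smul_ne_zero hr0 hy)) hO
    (fun w hwO hw y hy hyw => by
      have := hP w hwO hw (r • y) (smul_ne_zero hr0 hy) (by simp [hyw])
      rw [← this]
      congr 1
      rw [map_smul, smul_add, smul_comm, smul_comm r s])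
    (θ := r⁻¹ • θ) (by
      rw [smul_dotProduct, dotProduct_smul, ← hr2, smul_eq_mul, smul_eq_mul]
      field_simp) hw (by simp [hθw]) hwO
  simpa [smul_smul, hr0] using this

/-- The version of `eq_zero_of_rotation` where the sense of the rotation may depend on the axis. -/
theorem eq_zero_of_rotation_or {c s : ℝ} (hcs : c ^ 2 + s ^ 2 = 1) (hs : s ≠ 0)
    {F G : (Fin 3 → ℝ) → ℝ} (hF : ContinuousOn F {0}ᶜ) (hG : ContinuousOn G {0}ᶜ)
    (hodd : ∀ y, y ≠ 0 → F (-y) = -F y) {O : Set (Fin 3 → ℝ)} (hO : IsOpen O)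
    (hP : ∀ w ∈ O, w ⬝ᵥ w = 1 →
      (∀ y, y ≠ 0 → y ⬝ᵥ w = 0 → F (c • y + s • (w ⨯₃ y)) = G y) ∨
      (∀ y, y ≠ 0 → y ⬝ᵥ w = 0 → F (c • y + (-s) • (w ⨯₃ y)) = G y))
    {θ w : Fin 3 → ℝ} (hθ : θ ≠ 0) (hw : w ⬝ᵥ w = 1) (hθw : θ ⬝ᵥ w = 0) (hwO : w ∈ O) :
    F θ = 0 := by
  by_contra hne
  have hproj : ∀ y : Fin 3 → ℝ, Continuous fun v : Fin 3 → ℝ => y - (y ⬝ᵥ v) • v := fun y => by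
    fun_prop
  have hproj0 : ∀ y v : Fin 3 → ℝ, v ⬝ᵥ v = 1 → (y - (y ⬝ᵥ v) • v) ⬝ᵥ v = 0 := fun y v hv => by
    simp [sub_dotProduct, hv]
  have hFc : ∀ y, y ≠ 0 → ContinuousAt F y := fun y hy =>
    hF.continuousAt (isOpen_compl_singleton.mem_nhds hy)
  have hGc : ∀ y, y ≠ 0 → ContinuousAt G y := fun y hy =>
    hG.continuousAt (isOpen_compl_singleton.mem_nhds hy)
  have hw' : θ - (θ ⬝ᵥ w) • w = θ := by simp [hθw]
  have e1 : ∀ᶠ v in 𝓝 w, θ - (θ ⬝ᵥ v) • v ≠ 0 :=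
    (hproj θ).continuousAt.eventually_ne (by rwa [hw'])
  have e2 : ∀ᶠ v in 𝓝 w, F (θ - (θ ⬝ᵥ v) • v) ≠ 0 := by
    refine ContinuousAt.eventually_ne (ContinuousAt.comp (g := F) ?_ (hproj θ).continuousAt) ?_
    · rw [hw']; exact hFc θ hθ
    · rwa [hw']
  obtain ⟨N, hN, hNo, hwN⟩ := eventually_nhds_iff.1 (e1.and (e2.and (hO.mem_nhds hwO)))
  by_cases hall : ∀ v ∈ N, v ⬝ᵥ v = 1 →
      ∀ y, y ≠ 0 → y ⬝ᵥ v = 0 → F (c • y + s • (v ⨯₃ y)) = G y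
  · exact hne (eq_zero_of_rotation hcs hs hodd hNo hall hθ hw hθw hwN)
  · push Not at hall
    obtain ⟨v, hvN, hv, y, hy, hyv, hFG⟩ := hall
    have hy' : y - (y ⬝ᵥ v) • v = y := by simp [hyv]
    have hcv : Continuous fun u : Fin 3 → ℝ =>
        c • (y - (y ⬝ᵥ u) • u) + s • (u ⨯₃ (y - (y ⬝ᵥ u) • u)) :=
      ((hproj y).const_smul c).add ((continuous_cross continuous_id (hproj y)).const_smul s)
    have hrot : c • y + s • (v ⨯₃ y) ≠ 0 := by
      intro h0
      have h := dotProduct_rotation hcs hv hyv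
      rw [h0, dotProduct_zero] at h
      exact hy (dotProduct_self_eq_zero.1 h.symm)
    have f1 : ∀ᶠ u in 𝓝 v, y - (y ⬝ᵥ u) • u ≠ 0 :=
      (hproj y).continuousAt.eventually_ne (by rwa [hy'])
    have f2 : ∀ᶠ u in 𝓝 v, F (c • (y - (y ⬝ᵥ u) • u) + s • (u ⨯₃ (y - (y ⬝ᵥ u) • u)))
        ≠ G (y - (y ⬝ᵥ u) • u) := by
      have hA : ContinuousAt (fun u => F (c • (y - (y ⬝ᵥ u) • u) +
          s • (u ⨯₃ (y - (y ⬝ᵥ u) • u)))) v := by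
        refine ContinuousAt.comp (g := F) ?_ hcv.continuousAt
        rw [hy']; exact hFc _ hrot
      have hB : ContinuousAt (fun u => G (y - (y ⬝ᵥ u) • u)) v := by
        refine ContinuousAt.comp (g := G) ?_ (hproj y).continuousAt
        rw [hy']; exact hGc _ hy
      have := (hA.sub hB).eventually_ne (y := (0 : ℝ)) (by simpa [hyv] using sub_ne_zero.2 hFG)
      filter_upwards [this] with u hu using sub_ne_zero.1 hu
    obtain ⟨M, hM, hMo, hvM⟩ := eventually_nhds_iff.1 (f1.and (f2.and (hNo.mem_nhds hvN)))
    refine (hN v hvN).2.1 (eq_zero_of_rotation (s := -s) (G := G) (by simpa using hcs)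
      (neg_ne_zero.2 hs) hodd hMo (fun u hu hu1 => ?_) (hN v hvN).1 hv (hproj0 θ v hv) hvM)
    obtain ⟨g1, g2, g3⟩ := hM u hu
    exact (hP u (hN u g3).2.2 hu1).resolve_left fun h => g2 (h _ g1 (hproj0 y u hu1))

/-- Euclidean coordinates on the orthogonal complement of a unit vector of `ℝ⁴`. -/
theorem exists_coordinates {ζ : E4} (hζ : ζ ∈ sph) :
    ∃ L : (Fin 3 → ℝ) →ₗ[ℝ] E4, (∀ u v, ⟪L u, L v⟫ = u ⬝ᵥ v) ∧ (∀ u, ⟪L u, ζ⟫ = 0) ∧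
      ∀ x, ⟪x, ζ⟫ = 0 → ∃ u, L u = x := by
  have hζ0 : ζ ≠ 0 := by
    rintro rfl
    simp [sph] at hζ
  have := Fact.mk (@finrank_euclideanSpace_fin ℝ _ (3 + 1))
  let B := (OrthonormalBasis.fromOrthogonalSpanSingleton (𝕜 := ℝ) 3 hζ0).repr
  refine ⟨(ℝ ∙ ζ)ᗮ.subtype ∘ₗ B.symm.toLinearEquiv.toLinearMap ∘ₗ
    (WithLp.linearEquiv 2 ℝ (Fin 3 → ℝ)).symm.toLinearMap, fun u v => ?_, fun u => ?_,
    fun x hx => ?_⟩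
  · change ⟪B.symm (WithLp.toLp 2 u), B.symm (WithLp.toLp 2 v)⟫ = _
    rw [LinearIsometryEquiv.inner_map_map, EuclideanSpace.inner_eq_star_dotProduct]
    simp [dotProduct_comm]
  · exact (Submodule.mem_orthogonal_singleton_iff_inner_left).1 (B.symm (WithLp.toLp 2 u)).2
  · let x' : (ℝ ∙ ζ)ᗮ := ⟨x, (Submodule.mem_orthogonal_singleton_iff_inner_left).2 hx⟩
    refine ⟨(B x').ofLp, ?_⟩
    change ((B.symm (B x') : (ℝ ∙ ζ)ᗮ) : E4) = x
    simp [x']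

/-- In coordinates, a rotation by a given angle is a rotation in one of the two senses. -/
theorem IsRotAngleAbout.eq_or_eq {ζ : E4} {L : (Fin 3 → ℝ) →ₗ[ℝ] E4}
    (hL : ∀ u v, ⟪L u, L v⟫ = u ⬝ᵥ v) (hLζ : ∀ u, ⟪L u, ζ⟫ = 0)
    (hLs : ∀ x, ⟪x, ζ⟫ = 0 → ∃ u, L u = x) {w : Fin 3 → ℝ} (hw : w ⬝ᵥ w = 1) {α : ℝ}
    {φ : E4 ≃ₗᵢ[ℝ] E4} (hφ : IsRotAngleAbout (L w) ζ α φ) {c s : ℝ}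
    (hcs : c ^ 2 + s ^ 2 = 1) (hc : c = Real.cos (α * Real.pi)) :
    (∀ y, y ⬝ᵥ w = 0 → φ (L y) = L (c • y + s • (w ⨯₃ y))) ∨
    (∀ y, y ⬝ᵥ w = 0 → φ (L y) = L (c • y + (-s) • (w ⨯₃ y))) := by
  obtain ⟨⟨hφw, -⟩, hφζ, hang⟩ := hφ
  by_cases htriv : ∀ v, v ⬝ᵥ w = 0 → v = 0
  · left
    intro y hy
    simp [htriv y hy]
  push Not at htriv
  obtain ⟨v, hvw, hv0⟩ := htriv
  have hvv : v ⬝ᵥ v ≠ 0 := fun h => hv0 (dotProduct_self_eq_zero.1 h)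
  have hwv : w ⬝ᵥ v = 0 := by rw [dotProduct_comm, hvw]
  set e := w ⨯₃ v with he
  have hew : e ⬝ᵥ w = 0 := by rw [dotProduct_comm, he, dot_self_cross]
  have hve : v ⬝ᵥ e = 0 := dot_cross_self _ _
  have hev : e ⬝ᵥ v = 0 := by rw [dotProduct_comm, hve]
  have hee : e ⬝ᵥ e = v ⬝ᵥ v := by rw [he, cross_dot_cross, hw, hvw, hwv]; ring
  have hwe : w ⨯₃ e = -v := by
    rw [he, cross_cross_eq_smul_sub_smul_right, hwv, hw]; simp
  have hexp : ∀ y, y ⬝ᵥ w = 0 → (v ⬝ᵥ v) • y = (y ⬝ᵥ v) • v + (y ⬝ᵥ e) • e := by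
    intro y hy
    have h1 : v ⨯₃ e = (v ⬝ᵥ v) • w := by
      rw [he, cross_cross_eq_smul_sub_smul_right, hvw]; simp
    have h2 : y ⨯₃ (v ⨯₃ e) = (y ⬝ᵥ e) • v - (y ⬝ᵥ v) • e :=
      cross_cross_eq_smul_sub_smul_right _ _ _
    have h3 : w ⨯₃ (y ⨯₃ w) = y := by
      rw [cross_cross_eq_smul_sub_smul_right, hw, dotProduct_comm w, hy]; simp
    have h4 := congrArg (fun z => w ⨯₃ z) h2
    simp only [h1, map_smul, h3, map_sub, hwe] at h4
    rw [h4, ← he]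
    simp [add_comm]
  have himage : ∀ y, y ⬝ᵥ w = 0 → ∃ p, φ (L y) = L p ∧ p ⬝ᵥ w = 0 ∧ p ⬝ᵥ y = c * (y ⬝ᵥ y) := by
    intro y hy
    obtain ⟨p, hp⟩ := hLs (φ (L y)) (by
      rw [← hLζ y]
      conv_lhs => rw [← hφζ]
      exact φ.inner_map_map _ _)
    refine ⟨p, hp.symm, ?_, ?_⟩
    · rw [← hL, hp, ← hy, ← hL y w]
      conv_lhs => rw [← hφw]
      exact φ.inner_map_map _ _
    · rw [← hL, hp, hang _ (by rw [hL, hy]) (hLζ y), hL, hc]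
  obtain ⟨p, hp, hpw, hpv⟩ := himage v hvw
  obtain ⟨r, hr, hrw, hre⟩ := himage e hew
  have hsum := hang (L (v + e)) (by rw [hL, add_dotProduct, hvw, hew, add_zero]) (hLζ _)
  rw [map_add, map_add, hp, hr, ← map_add, ← map_add, hL, hL, ← hc] at hsum
  simp only [add_dotProduct, dotProduct_add, hpv, hre, hve, hev, hee] at hsum
  have hpe : r ⬝ᵥ v = -(p ⬝ᵥ e) := by linarith
  have hpp : p ⬝ᵥ p = v ⬝ᵥ v := by
    rw [← hL, ← hp, φ.inner_map_map, hL]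
  have hpx := hexp p hpw
  have hrx := hexp r hrw
  rw [hpv] at hpx
  rw [hre, hpe, hee] at hrx
  set a := (p ⬝ᵥ e) / (v ⬝ᵥ v) with ha
  have hpe' : p ⬝ᵥ e = a * (v ⬝ᵥ v) := by rw [ha]; field_simp
  have hp' : p = c • v + a • e := by
    apply smul_right_injective _ hvv
    simp only [hpx, hpe', smul_add, smul_smul]
    module
  have hr' : r = c • e - a • v := by
    apply smul_right_injective _ hvv
    simp only [hrx, hpe', smul_sub, smul_smul]
    module
  have ha2 : (a - s) * (a + s) = 0 := by
    have h := hpp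
    rw [hp'] at h
    simp only [add_dotProduct, smul_dotProduct, dotProduct_add, dotProduct_smul, hve, hev, hee,
      smul_eq_mul] at h
    apply mul_right_cancel₀ hvv
    linear_combination h - (v ⬝ᵥ v) * hcs
  have hall : ∀ y, y ⬝ᵥ w = 0 → φ (L y) = L (c • y + a • (w ⨯₃ y)) := by
    intro y hy
    have hyx := hexp y hy
    apply smul_right_injective _ hvv
    change (v ⬝ᵥ v) • φ (L y) = (v ⬝ᵥ v) • L (c • y + a • (w ⨯₃ y))
    have h1 : (v ⬝ᵥ v) • (c • y + a • (w ⨯₃ y))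
        = c • ((v ⬝ᵥ v) • y) + a • (w ⨯₃ ((v ⬝ᵥ v) • y)) := by
      rw [map_smul]; module
    rw [← map_smul, ← map_smul, ← map_smul, h1, hyx]
    simp only [map_add, map_smul, hp, hr, hwe, ← he, hp', hr', map_sub, map_neg]
    module
  rcases mul_eq_zero.1 ha2 with h | h
  · left
    rwa [sub_eq_zero.1 h] at hall
  · right
    rwa [eq_neg_of_add_eq_zero_left h] at hall

theorem smul_add_smul_mem_sph_s5 {ζ : E4} (hζ : ζ ∈ sph) {L : (Fin 3 → ℝ) →ₗ[ℝ] E4}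
    (hL : ∀ u v, ⟪L u, L v⟫ = u ⬝ᵥ v) (hLζ : ∀ u, ⟪L u, ζ⟫ = 0) {x ρ : ℝ}
    (hxρ : x ^ 2 + ρ ^ 2 = 1) {y : Fin 3 → ℝ} (hy : y ≠ 0) :
    x • ζ + (ρ / √(y ⬝ᵥ y)) • L y ∈ sph := by
  have hpos : 0 < y ⬝ᵥ y := dotProduct_self_pos_of_ne_zero hy
  have hζ1 : ⟪ζ, ζ⟫ = 1 := by
    rw [real_inner_self_eq_norm_sq]
    simp only [sph, mem_sphere_iff_norm, sub_zero] at hζ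
    simp [hζ]
  have hζL : ⟪ζ, L y⟫ = 0 := by rw [real_inner_comm, hLζ]
  have hsq : √(y ⬝ᵥ y) ^ 2 = y ⬝ᵥ y := Real.sq_sqrt hpos.le
  have hne : √(y ⬝ᵥ y) ≠ 0 := (Real.sqrt_pos.2 hpos).ne'
  generalize √(y ⬝ᵥ y) = r at hsq hne ⊢
  simp only [sph, mem_sphere_iff_norm, sub_zero]
  rw [← sq_eq_sq₀ (norm_nonneg _) zero_le_one, ← real_inner_self_eq_norm_sq]
  simp only [inner_add_left, inner_add_right, real_inner_smul_left, real_inner_smul_right, hζ1,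
    hLζ, hζL, hL, ← hsq]
  field_simp
  linear_combination r * hxρ

theorem continuousOn_slice {ζ : E4} (hζ : ζ ∈ sph) {L : (Fin 3 → ℝ) →ₗ[ℝ] E4}
    (hL : ∀ u v, ⟪L u, L v⟫ = u ⬝ᵥ v) (hLζ : ∀ u, ⟪L u, ζ⟫ = 0) {x ρ : ℝ}
    (hxρ : x ^ 2 + ρ ^ 2 = 1) {f : E4 → ℝ} (hf : ContinuousOn f sph) :
    ContinuousOn (fun y => f (x • ζ + (ρ / √(y ⬝ᵥ y)) • L y)) {0}ᶜ := by
  refine hf.comp ?_ fun y hy => smul_add_smul_mem_sph_s5 hζ hL hLζ hxρ hy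
  have hLc : Continuous L := L.continuous_of_finiteDimensional
  have hn : Continuous fun y : Fin 3 → ℝ => √(y ⬝ᵥ y) := by fun_prop
  refine continuousOn_const.add (ContinuousOn.fun_smul ?_ hLc.continuousOn)
  refine continuousOn_const.div hn.continuousOn fun y hy => ?_
  have hpos : 0 < y ⬝ᵥ y := dotProduct_self_pos_of_ne_zero hy
  exact (Real.sqrt_pos.2 hpos).ne'

/-- A function odd with respect to `𝒪` vanishes on `S²(w)` for `w` in a cap of axes of rotations
by the angle `απ` carrying it to another function. -/
theorem eq_zero_of_cap_subset_Xi {ζ : E4} (hζ : ζ ∈ sph) {f g : E4 → ℝ}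
    (hf : ContinuousOn f sph) (hg : ContinuousOn g sph)
    (hfodd : ∀ θ ∈ sph, f (Ocal ζ θ) = - f θ) {α : ℝ} (hα : α ∈ Set.Ioo (0 : ℝ) 1)
    {c : E4} {t : ℝ} (hXi : {x ∈ S2 ζ | t < ⟪x, c⟫} ⊆ Xi f g ζ α)
    {w : E4} (hw : w ∈ S2 ζ) (hwc : t < ⟪w, c⟫) {θ : E4} (hθ : θ ∈ S2 w) : f θ = 0 := by
  obtain ⟨L, hL, hLζ, hLs⟩ := exists_coordinates hζ
  have hζ1 : ⟪ζ, ζ⟫ = 1 := by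
    rw [real_inner_self_eq_norm_sq]
    have := hζ
    simp only [sph, mem_sphere_iff_norm, sub_zero] at this
    simp [this]
  have hθ1 : ⟪θ, θ⟫ = 1 := by
    rw [real_inner_self_eq_norm_sq]
    have := hθ.1
    simp only [sph, mem_sphere_iff_norm, sub_zero] at this
    simp [this]
  have hunit : ∀ v, L v ∈ sph ↔ v ⬝ᵥ v = 1 := fun v => by
    simp only [sph, mem_sphere_iff_norm, sub_zero]
    rw [← sq_eq_sq₀ (norm_nonneg _) zero_le_one, ← real_inner_self_eq_norm_sq, hL, one_pow]
  obtain ⟨w, rfl⟩ := hLs w hw.2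
  set x := ⟪θ, ζ⟫ with hx
  obtain ⟨y, hy⟩ := hLs (θ - x • ζ) (by
    rw [inner_sub_left, real_inner_smul_left, hζ1, ← hx]; ring)
  have hθy : θ = x • ζ + L y := by rw [hy]; abel
  have hOcal : ∀ v, Ocal ζ (x • ζ + L v) = x • ζ + L (-v) := by
    intro v
    simp only [Ocal, inner_add_left, real_inner_smul_left, hζ1, hLζ, map_neg]
    module
  by_cases hy0 : y = 0
  · have h := hfodd θ hθ.1
    rw [hθy, hOcal, hy0, neg_zero] at h
    rw [hθy, hy0]
    linarith
  have hpos : 0 < y ⬝ᵥ y := dotProduct_self_pos_of_ne_zero hy0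
  set ρ := √(y ⬝ᵥ y) with hρ
  have hρ0 : ρ ≠ 0 := (Real.sqrt_pos.2 hpos).ne'
  have hρ2 : ρ ^ 2 = y ⬝ᵥ y := Real.sq_sqrt hpos.le
  have hζL : ⟪ζ, L y⟫ = 0 := by rw [real_inner_comm, hLζ]
  have hxρ : x ^ 2 + ρ ^ 2 = 1 := by
    rw [hρ2, ← hθ1]
    conv_rhs => rw [hθy]
    simp only [inner_add_left, inner_add_right, real_inner_smul_left, real_inner_smul_right, hζ1,
      hLζ, hζL, hL]
    ring
  have hsin : Real.sin (α * Real.pi) ≠ 0 := by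
    refine (Real.sin_pos_of_pos_of_lt_pi (mul_pos hα.1 Real.pi_pos) ?_).ne'
    have := mul_lt_mul_of_pos_right hα.2 Real.pi_pos
    linarith
  have hLc : Continuous L := L.continuous_of_finiteDimensional
  have hO : IsOpen {v : Fin 3 → ℝ | t < ⟪L v, c⟫} :=
    isOpen_lt continuous_const (hLc.inner continuous_const)
  have hyw : y ⬝ᵥ w = 0 := by
    rw [← hL, hy, inner_sub_left, hθ.2, real_inner_smul_left, real_inner_comm, hLζ]; ring
  have hcs := Real.cos_sq_add_sin_sq (α * Real.pi)
  have key := eq_zero_of_rotation_or hcs hsin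
    (continuousOn_slice hζ hL hLζ hxρ hf) (continuousOn_slice hζ hL hLζ hxρ hg)
    (fun v hv => by
      have := hfodd _ (smul_add_smul_mem_sph_s5 hζ hL hLζ hxρ hv)
      rw [← map_smul, hOcal] at this
      simpa only [neg_dotProduct_neg, smul_neg, map_neg, map_smul] using this) hO
    (fun v hv hv1 => by
      obtain ⟨-, φ, hφ, hfg⟩ := hXi ⟨⟨(hunit v).2 hv1, hLζ v⟩, hv⟩
      have hrot : ∀ s, Real.cos (α * Real.pi) ^ 2 + s ^ 2 = 1 →
          (∀ y, y ⬝ᵥ v = 0 → φ (L y) = L (Real.cos (α * Real.pi) • y + s • (v ⨯₃ y))) →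
          ∀ y, y ≠ 0 → y ⬝ᵥ v = 0 → f (x • ζ + (ρ / √((Real.cos (α * Real.pi) • y +
            s • (v ⨯₃ y)) ⬝ᵥ (Real.cos (α * Real.pi) • y + s • (v ⨯₃ y)))) •
            L (Real.cos (α * Real.pi) • y + s • (v ⨯₃ y))) =
            g (x • ζ + (ρ / √(y ⬝ᵥ y)) • L y) := by
        intro s hs h y hy hyv
        rw [dotProduct_rotation hs hv1 hyv, ← h y hyv, ← hfg _
          ⟨smul_add_smul_mem_sph_s5 hζ hL hLζ hxρ hy, ?_⟩]
        · rw [map_add, map_smul, map_smul, hφ.2.1]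
        · rw [inner_add_left, real_inner_smul_left, real_inner_smul_left, real_inner_comm, hLζ,
            hL, hyv]
          ring
      rcases hφ.eq_or_eq hL hLζ hLs hv1 hcs rfl with h | h
      · exact Or.inl (hrot _ hcs h)
      · exact Or.inr (hrot _ (by simp) h))
    hy0 ((hunit w).1 hw.1) hyw hwc
  simp only [← hρ, div_self hρ0, one_smul] at key
  rwa [hθy]

end

/-- Lemma: on an open spherical cap `U ⊆ Ξ_{p/q}`, `p/q ∈ (0,1)`,
the odd functions `f` and `g` vanish on `S²(w)` for every `w ∈ U`. -/
theorem stmt_5 (ζ : E4) (hζ : ζ ∈ sph) (f g : E4 → ℝ)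
    (hf : ContinuousOn f sph) (hg : ContinuousOn g sph)
    (hfodd : ∀ θ ∈ sph, f (Ocal ζ θ) = - f θ)
    (hgodd : ∀ θ ∈ sph, g (Ocal ζ θ) = - g θ)
    (q : ℚ) (hq : (q : ℝ) ∈ Set.Ioo (0:ℝ) 1)
    (U : Set E4) (c : E4) (hc : c ∈ S2 ζ) (t : ℝ) (ht : t < 1)
    (hcap : U = {x ∈ S2 ζ | t < ⟪x, c⟫}) (hUne : U.Nonempty)
    (hUXi : U ⊆ Xi f g ζ (q : ℝ)) :
    ∀ w ∈ U, ∀ θ ∈ S2 w, f θ = 0 ∧ g θ = 0 := by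
  subst hcap
  intro w hw θ hθ
  have hzero := fun η (hη : η ∈ S2 w) =>
    eq_zero_of_cap_subset_Xi hζ hf hg hfodd hq hUXi hw.1 hw.2 hη
  obtain ⟨-, φ, ⟨⟨hφw, -⟩, -, -⟩, hfg⟩ := hUXi hw
  refine ⟨hzero θ hθ, ?_⟩
  rw [← hfg θ hθ]
  refine hzero _ ⟨?_, ?_⟩
  · simpa [sph] using hθ.1
  · have h := φ.inner_map_map θ w
    rwa [hφw, hθ.2] at h
end
end

section
/- Let f and g be continuous real-valued functions on S³ and ζ ∈ S³. Assume that for every w ∈ S²(ζ) there exists a rotation φ_w ∈ SO(3, S²(w)) with φ_w(ζ) = ±ζ such that f∘φ_w = g on S²(w), and that for every w ∈ S²(ζ), neither f nor g has a (ζ, π)-rotational symmetry on S²(w), nor a (u, π)-rotational symmetry on S²(w) for any u ∈ S²(ζ) ∩ S²(w). Then (Ξ₀ ∪ Ξ₁) ∩ Ψ = ∅. -/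
noncomputable section

open scoped RealInnerProductSpace

/-- The function `f` has a `(u, π)`-rotational symmetry on `S²(ξ)`:
`f ∘ φ = f` on `S²(ξ)` for the rotation `φ ∈ SO(3, S²(ξ))` by the angle `π` about `u`. -/
def HasPiRotSym (f : E4 → ℝ) (ξ u : E4) : Prop :=
  ∃ φ : E4 ≃ₗᵢ[ℝ] E4, IsRotAngleAbout ξ u 1 φ ∧ ∀ θ ∈ S2 ξ, f (φ θ) = f θ

/-- The set `Ξ₀ = {w ∈ S²(ζ) : f = g on S²(w)}`. -/
def Xi0 (f g : E4 → ℝ) (ζ : E4) : Set E4 :=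
  {w ∈ S2 ζ | ∀ θ ∈ S2 w, f θ = g θ}

/-- The set `Ξ₁ = {w ∈ S²(ζ) : f(θ) = g(𝒪θ) for all θ ∈ S²(w)}`. -/
def Xi1 (f g : E4 → ℝ) (ζ : E4) : Set E4 :=
  {w ∈ S2 ζ | ∀ θ ∈ S2 w, f θ = g (Ocal ζ θ)}

/-- The set `Ψ`: directions `w ∈ S²(ζ)` admitting a rotation `φ ∈ SO(3, S²(w))` with
`φ ζ = -ζ` carrying `f` to `g` on `S²(w)`. -/
def Psi (f g : E4 → ℝ) (ζ : E4) : Set E4 :=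
  {w ∈ S2 ζ | ∃ φ : E4 ≃ₗᵢ[ℝ] E4, IsRot w φ ∧ φ ζ = -ζ ∧ ∀ θ ∈ S2 w, f (φ θ) = g θ}

/-- Half-angle parametrization of the unit circle. -/
lemma exists_half_angle {a b : ℝ} (h : a ^ 2 + b ^ 2 = 1) :
    ∃ p q : ℝ, p ^ 2 + q ^ 2 = 1 ∧ a = p ^ 2 - q ^ 2 ∧ b = 2 * p * q := by
  obtain ⟨z, hz⟩ := IsAlgClosed.exists_eq_mul_self (⟨a, b⟩ : ℂ)
  have h₁ : a = z.re * z.re - z.im * z.im := by simpa using congrArg Complex.re hz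
  have h₂ : b = z.re * z.im + z.im * z.re := by simpa using congrArg Complex.im hz
  refine ⟨z.re, z.im, ?_, by linarith, by linarith⟩
  have h₃ : (z.re ^ 2 + z.im ^ 2) ^ 2 = 1 := by rw [← h, h₁, h₂]; ring
  nlinarith [sq_nonneg z.re, sq_nonneg z.im]

/-- Two orthonormal vectors of `ℝ⁴` extend to an orthonormal basis. -/
lemma exists_orthonormalBasis_of_pair {w ζ : E4} (hw : ‖w‖ = 1) (hζ : ‖ζ‖ = 1)
    (hwζ : ⟪w, ζ⟫ = 0) :
    ∃ b : OrthonormalBasis (Fin 4) ℝ E4, b 0 = w ∧ b 1 = ζ := by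
  have hv : Orthonormal ℝ (({0, 1} : Set (Fin 4)).domRestrict ![w, ζ, 0, 0]) := by
    rw [orthonormal_iff_ite]
    rintro ⟨i, hi⟩ ⟨j, hj⟩
    simp only [Set.domRestrict_apply, Subtype.mk.injEq]
    rcases hi with rfl | rfl <;> rcases hj with rfl | rfl <;>
      simp [hw, hζ, hwζ, real_inner_comm w ζ]
  obtain ⟨b, hb⟩ := hv.exists_orthonormalBasis_extension_of_card_eq (by simp)
  exact ⟨b, by simpa using hb 0 (by simp), by simpa using hb 1 (by simp)⟩

/-- A rotation of `w^⊥` reversing a unit vector `ζ ∈ w^⊥` is a half-turn about a unit vector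
orthogonal to `w` and `ζ`. -/
lemma IsRot.exists_axis_of_neg {w ζ : E4} {φ : E4 ≃ₗᵢ[ℝ] E4} (hζ : ζ ∈ sph) (hw : w ∈ S2 ζ)
    (hφ : IsRot w φ) (hφζ : φ ζ = -ζ) :
    ∃ u ∈ S2 ζ ∩ S2 w, IsRotAngleAbout w u 1 φ := by
  have hw₁ : ‖w‖ = 1 := by simpa [sph] using hw.1
  have hζ₁ : ‖ζ‖ = 1 := by simpa [sph] using hζ
  obtain ⟨b, rfl, rfl⟩ := exists_orthonormalBasis_of_pair hw₁ hζ₁ hw.2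
  have hb : ∀ i j, ⟪b i, b j⟫ = if i = j then 1 else 0 := orthonormal_iff_ite.1 b.orthonormal
  have hrow₀ : ∀ j, ⟪b 0, φ (b j)⟫ = if 0 = j then 1 else 0 := fun j => by
    rw [← hb, ← φ.inner_map_map (b 0) (b j), hφ.1]
  have hrow₁ : ∀ j, ⟪b 1, φ (b j)⟫ = -if 1 = j then 1 else 0 := fun j => by
    rw [← hb, ← φ.inner_map_map (b 1) (b j), hφζ, inner_neg_left, neg_neg]
  have hcol : ∀ i j, ∑ k, ⟪b k, φ (b i)⟫ * ⟪b k, φ (b j)⟫ = if i = j then 1 else 0 :=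
    fun i j => by
      rw [← hb, ← φ.inner_map_map (b i) (b j), ← b.sum_inner_mul_inner]
      simp only [real_inner_comm]
  have hdet : ⟪b 2, φ (b 2)⟫ * ⟪b 3, φ (b 3)⟫ - ⟪b 2, φ (b 3)⟫ * ⟪b 3, φ (b 2)⟫ = -1 := by
    have h := hφ.2
    rw [← LinearMap.det_toMatrix b.toBasis, Matrix.det_succ_row_zero] at h
    simp [Matrix.det_fin_three, LinearMap.toMatrix_apply,
      OrthonormalBasis.repr_apply_apply, hrow₀, hrow₁, Fin.succAbove] at h
    linear_combination -h
  have h₂₂ := hcol 2 2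
  have h₃₃ := hcol 3 3
  simp [Fin.sum_univ_four, hrow₀, hrow₁] at h₂₂ h₃₃
  have hsq : (⟪b 2, φ (b 2)⟫ + ⟪b 3, φ (b 3)⟫) ^ 2 +
      (⟪b 2, φ (b 3)⟫ - ⟪b 3, φ (b 2)⟫) ^ 2 = 0 := by
    linear_combination h₂₂ + h₃₃ + 2 * hdet
  have hδ : ⟪b 3, φ (b 3)⟫ = -⟪b 2, φ (b 2)⟫ := by nlinarith
  have hγ : ⟪b 2, φ (b 3)⟫ = ⟪b 3, φ (b 2)⟫ := by nlinarith
  obtain ⟨p, q, hpq, hα, hβ⟩ := exists_half_angle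
    (a := ⟪b 2, φ (b 2)⟫) (b := ⟪b 3, φ (b 2)⟫) (by linarith)
  have hφ₂ : φ (b 2) = (p ^ 2 - q ^ 2) • b 2 + (2 * p * q) • b 3 := by
    rw [← b.sum_repr' (φ (b 2))]
    simp [Fin.sum_univ_four, hrow₀, hrow₁, hα, hβ]
  have hφ₃ : φ (b 3) = (2 * p * q) • b 2 + (q ^ 2 - p ^ 2) • b 3 := by
    rw [← b.sum_repr' (φ (b 3))]
    simp [Fin.sum_univ_four, hrow₀, hrow₁, hγ, hδ, hα, hβ]
  have hu : p • b 2 + q • b 3 ∈ sph := by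
    have : ‖p • b 2 + q • b 3‖ ^ 2 = 1 := by
      rw [← real_inner_self_eq_norm_sq]
      simp only [inner_add_left, inner_add_right, real_inner_smul_left, real_inner_smul_right, hb]
      simp
      linarith
    rw [sph, mem_sphere_zero_iff_norm]
    nlinarith [norm_nonneg (p • b 2 + q • b 3)]
  refine ⟨p • b 2 + q • b 3, ⟨⟨hu, ?_⟩, ⟨hu, ?_⟩⟩, hφ, ?_, ?_⟩
  · simp [inner_add_left, inner_smul_left, hb]
  · simp [inner_add_left, inner_smul_left, hb]
  · rw [map_add, map_smul, map_smul, hφ₂, hφ₃]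
    match_scalars
    · linear_combination p * hpq
    · linear_combination q * hpq
  · intro v hv₀ hvu
    have hv : v = ⟪b 1, v⟫ • b 1 + ⟪b 2, v⟫ • b 2 + ⟪b 3, v⟫ • b 3 := by
      conv_lhs => rw [← b.sum_repr' v]
      rw [real_inner_comm] at hv₀
      simp [Fin.sum_univ_four, hv₀]
    generalize ⟪b 1, v⟫ = x at hv
    generalize ⟪b 2, v⟫ = y at hv
    generalize ⟪b 3, v⟫ = z at hv
    subst hv
    simp [inner_add_left, inner_add_right, inner_smul_left, inner_smul_right, hb] at hvu
    simp only [map_add, map_smul, hφ₂, hφ₃, hφζ, inner_add_left, inner_add_right, inner_neg_left,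
      real_inner_smul_left, real_inner_smul_right, hb]
    simp
    linear_combination 2 * (p * y + q * z) * hvu - (y ^ 2 + z ^ 2) * hpq

/-- The half-turn about `ζ` in `w^⊥` agrees with `Ocal ζ` on `w^⊥`. -/
lemma exists_isRot_eq_Ocal {w ζ : E4} (hζ : ζ ∈ sph) (hw : w ∈ S2 ζ) :
    ∃ R : E4 ≃ₗᵢ[ℝ] E4, IsRot w R ∧ ∀ θ, ⟪θ, w⟫ = 0 → R θ = Ocal ζ θ := by
  have hw₁ : ‖w‖ = 1 := by simpa [sph] using hw.1
  have hζ₁ : ‖ζ‖ = 1 := by simpa [sph] using hζ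
  have hζw : ⟪ζ, w⟫ = 0 := by rw [real_inner_comm]; exact hw.2
  have hK : Orthonormal ℝ ![w, ζ] := by
    rw [orthonormal_iff_ite]
    intro i j
    fin_cases i <;> fin_cases j <;> simp [hw₁, hζ₁, hw.2, hζw]
  set K : Submodule ℝ E4 := Submodule.span ℝ (Set.range ![w, ζ]) with hKdef
  have hwK : w ∈ K := Submodule.subset_span ⟨0, rfl⟩
  have hζK : ζ ∈ K := Submodule.subset_span ⟨1, rfl⟩
  have hrank : Module.finrank ℝ Kᗮ = 2 := by
    have h₁ := finrank_span_eq_card hK.linearIndependent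
    have h₂ := K.finrank_add_finrank_orthogonal
    rw [← hKdef] at h₁
    simp at h₁ h₂
    omega
  refine ⟨K.reflection, ⟨Submodule.reflection_mem_subspace_eq_self hwK, ?_⟩, fun θ hθ => ?_⟩
  · have := K.det_reflection
    rw [hrank] at this
    simpa using this
  · have hmem : θ - ⟪θ, ζ⟫ • ζ ∈ Kᗮ := by
      rw [hKdef, Submodule.mem_orthogonal']
      intro x hx
      induction hx using Submodule.span_induction with
      | mem x hx =>
        obtain ⟨i, rfl⟩ := hx
        fin_cases i <;> simp [inner_sub_left, inner_smul_left, hθ, hζw, hζ₁]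
      | zero => simp
      | add x y _ _ hx hy => rw [inner_add_right, hx, hy, add_zero]
      | smul a x _ hx => rw [inner_smul_right, hx, mul_zero]
    have h := Submodule.reflection_mem_subspace_orthogonalComplement_eq_neg hmem
    rw [map_sub, map_smul, Submodule.reflection_mem_subspace_eq_self hζK] at h
    rw [sub_eq_iff_eq_add.1 h, Ocal]
    module

/-- Lemma: `(Ξ₀ ∪ Ξ₁) ∩ Ψ = ∅`. -/
theorem stmt_8 (ζ : E4) (hζ : ζ ∈ sph) (f g : E4 → ℝ)
    (hf : ContinuousOn f sph) (hg : ContinuousOn g sph)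
    (hrot : ∀ w ∈ S2 ζ, ∃ φ : E4 ≃ₗᵢ[ℝ] E4,
      IsRot w φ ∧ (φ ζ = ζ ∨ φ ζ = -ζ) ∧ ∀ θ ∈ S2 w, f (φ θ) = g θ)
    (hsym : ∀ w ∈ S2 ζ,
      (¬ HasPiRotSym f w ζ ∧ ¬ HasPiRotSym g w ζ) ∧
      ∀ u ∈ S2 ζ ∩ S2 w, ¬ HasPiRotSym f w u ∧ ¬ HasPiRotSym g w u) :
    (Xi0 f g ζ ∪ Xi1 f g ζ) ∩ Psi f g ζ = ∅ := by
  rw [Set.eq_empty_iff_forall_notMem]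
  rintro w ⟨hΞ, hw, φ, hφ, hφζ, hfg⟩
  have key : ∀ ψ : E4 ≃ₗᵢ[ℝ] E4, IsRot w ψ → ψ ζ = -ζ → ¬ ∀ θ ∈ S2 w, f (ψ θ) = f θ := by
    intro ψ hψ hψζ hinv
    obtain ⟨u, hu, hrotu⟩ := hψ.exists_axis_of_neg hζ hw hψζ
    exact ((hsym w hw).2 u hu).1 ⟨ψ, hrotu, hinv⟩
  rcases hΞ with hΞ | hΞ
  · exact key φ hφ hφζ fun θ hθ => (hfg θ hθ).trans (hΞ.2 θ hθ).symm
  · obtain ⟨R, hR, hRO⟩ := exists_isRot_eq_Ocal hζ hw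
    have hζw : ⟪ζ, w⟫ = 0 := by rw [real_inner_comm]; exact hw.2
    refine key (R.trans φ) ⟨?_, ?_⟩ ?_ fun θ hθ => ?_
    · simp [hR.1, hφ.1]
    · have : ((R.trans φ).toLinearEquiv : E4 →ₗ[ℝ] E4) =
          (φ.toLinearEquiv : E4 →ₗ[ℝ] E4) ∘ₗ (R.toLinearEquiv : E4 →ₗ[ℝ] E4) := rfl
      rw [this, LinearMap.det_comp, hφ.2, hR.2, mul_one]
    · have hRζ : R ζ = ζ := by
        have hζ₁ : ‖ζ‖ = 1 := by simpa [sph] using hζ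
        rw [hRO ζ hζw, Ocal, real_inner_self_eq_norm_sq, hζ₁]
        module
      simp [hRζ, hφζ]
    · have hRθ : R θ ∈ S2 w := by
        refine ⟨by simpa [sph] using hθ.1, ?_⟩
        rw [← hR.1, R.inner_map_map]
        exact hθ.2
      rw [LinearIsometryEquiv.trans_apply, hfg _ hRθ, hRO θ hθ.2, hΞ.2 θ hθ]
end
end
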